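/- (Proposition 2, asymptotic normality of the plug-in efficient estimator.) Under Assumptions 1, 2 and 3, with V*_{X̂} := Σ_{g∈𝒢} p_g^{-1} A_{0,g} S*_g A_{0,g}′ positive definite, the plug-in efficient estimator θ̂_{β̂*} := θ̂₀ − X̂′β̂* satisfies √N(θ̂_{β̂*} − θ) →d N(0, σ*²), where σ*² := V*_{θ̂₀} − V*_{X̂,θ̂₀}′ (V*_{X̂})^{-1} V*_{X̂,θ̂₀}, with V*_{θ̂₀} := Σ_g p_g^{-1} A_{θ,g} S*_g A_{θ,g}′ − S*_θ and V*_{X̂,θ̂₀} := Σ_g p_g^{-1} A_{0,g} S*_g A_{θ,g}′; moreover σ*² = lim_{N→∞} N·Var(θ̂_{β*}), where β* := Var(X̂)^{-1} Cov(X̂, θ̂₀) is the oracle coefficient in each population. -/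

import Mathlib

open Finset Filter Topology Matrix MeasureTheory ProbabilityTheory
open scoped BigOperators Classical ENNReal NNReal

noncomputable section

namespace Staggered

/-- Treatment dates: `ℕ∞ = ℕ ∪ {∞}`; `⊤` means never treated. -/
abbrev Date : Type := ℕ∞

/-- Period `t : Fin T` stands for calendar period `t + 1`; `periodLT t g` says that period `t`
is strictly earlier than the treatment date `g` (i.e. `g > t`). -/
def periodLT {T : ℕ} (t : Fin T) (g : Date) : Prop := (((t : ℕ) + 1 : ℕ) : Date) < g

/-- Assumption 1 sample space: the valid assignment vectors, i.e. those in which exactly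
`Ng g` units have first-treatment date `g`, for every `g ∈ 𝒢`. -/
def assigns (N : ℕ) (𝒢 : Finset Date) (Ng : Date → ℕ) : Finset (Fin N → 𝒢) :=
  Finset.univ.filter fun d => ∀ g ∈ 𝒢, (Finset.univ.filter fun i => (d i : Date) = g).card = Ng g

/-- Expectation under the uniform distribution on valid assignments (Assumption 1). -/
def expec (N : ℕ) (𝒢 : Finset Date) (Ng : Date → ℕ) (f : (Fin N → 𝒢) → ℝ) : ℝ :=
  (∑ d ∈ assigns N 𝒢 Ng, f d) / ((assigns N 𝒢 Ng).card : ℝ)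

/-- Probability of an event under the uniform distribution on valid assignments. -/
def prob (N : ℕ) (𝒢 : Finset Date) (Ng : Date → ℕ) (p : (Fin N → 𝒢) → Prop) : ℝ :=
  (((assigns N 𝒢 Ng).filter p).card : ℝ) / ((assigns N 𝒢 Ng).card : ℝ)

/-- Variance of a real statistic under the uniform distribution on valid assignments. -/
def varE (N : ℕ) (𝒢 : Finset Date) (Ng : Date → ℕ) (f : (Fin N → 𝒢) → ℝ) : ℝ :=
  expec N 𝒢 Ng fun d => (f d - expec N 𝒢 Ng f) ^ 2

/-- Covariance of two real statistics under the uniform distribution on valid assignments. -/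
def covE (N : ℕ) (𝒢 : Finset Date) (Ng : Date → ℕ) (f h : (Fin N → 𝒢) → ℝ) : ℝ :=
  expec N 𝒢 Ng fun d => (f d - expec N 𝒢 Ng f) * (h d - expec N 𝒢 Ng h)

/-- Observed outcome vectors `Y_i = Y_i(G_i)`. -/
def obs {N T : ℕ} {𝒢 : Finset Date} (Y : Fin N → Date → Fin T → ℝ) (d : Fin N → 𝒢) :
    Fin N → Fin T → ℝ := fun i => Y i (d i)

/-- Cohort sample mean `Ȳ_g` computed from outcome data `y` and assignment `d`. -/
def cmean {N T : ℕ} {𝒢 : Finset Date} (Ng : Date → ℕ) (y : Fin N → Fin T → ℝ)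
    (d : Fin N → 𝒢) (g : Date) : Fin T → ℝ :=
  fun t => (∑ i, if (d i : Date) = g then y i t else 0) / (Ng g : ℝ)

/-- Finite-population mean of a scalar attribute. -/
def popMeanS (N : ℕ) (w : Fin N → ℝ) : ℝ := (∑ i, w i) / (N : ℝ)

/-- Finite-population variance (normalized by `N - 1`) of a scalar attribute. -/
def popVarS (N : ℕ) (w : Fin N → ℝ) : ℝ :=
  (∑ i, (w i - popMeanS N w) ^ 2) / ((N : ℝ) - 1)

/-- Finite-population mean of a vector attribute. -/
def popMeanV (N K : ℕ) (W : Fin N → Fin K → ℝ) : Fin K → ℝ := fun k => (∑ i, W i k) / (N : ℝ)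

/-- Finite-population covariance matrix (normalized by `N - 1`) of a vector attribute. -/
def popCov (N K : ℕ) (W : Fin N → Fin K → ℝ) : Matrix (Fin K) (Fin K) ℝ :=
  Matrix.of fun k l =>
    (∑ i, (W i k - popMeanV N K W k) * (W i l - popMeanV N K W l)) / ((N : ℝ) - 1)

/-- Finite-population cross-covariance matrix of two vector attributes. -/
def popCrossCov (N K : ℕ) (W V : Fin N → Fin K → ℝ) : Matrix (Fin K) (Fin K) ℝ :=
  Matrix.of fun k l =>
    (∑ i, (W i k - popMeanV N K W k) * (V i l - popMeanV N K V l)) / ((N : ℝ) - 1)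

/-- `S_g`: finite-population covariance matrix of the potential outcomes `Y(g)`. -/
def Sg (N T : ℕ) (Y : Fin N → Date → Fin T → ℝ) (g : Date) : Matrix (Fin T) (Fin T) ℝ :=
  popCov N T fun i => Y i g

/-- `S_{gg'}`: finite-population cross-covariance of `Y(g)` and `Y(g')`. -/
def Sgg (N T : ℕ) (Y : Fin N → Date → Fin T → ℝ) (g g' : Date) : Matrix (Fin T) (Fin T) ℝ :=
  popCrossCov N T (fun i => Y i g) (fun i => Y i g')

/-- Average treatment contrast `τ_{t,gg'}`. -/
def tau (N T : ℕ) (Y : Fin N → Date → Fin T → ℝ) (t : Fin T) (g g' : Date) : ℝ :=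
  (∑ i, (Y i g t - Y i g' t)) / (N : ℝ)

/-- Target parameter `θ = Σ_{t,g,g'} a_{t,gg'} τ_{t,gg'}`. -/
def thetaParam (N T : ℕ) (𝒢 : Finset Date) (Y : Fin N → Date → Fin T → ℝ)
    (a : Fin T → Date → Date → ℝ) : ℝ :=
  ∑ t, ∑ g ∈ 𝒢, ∑ g' ∈ 𝒢, a t g g' * tau N T Y t g g'

/-- Sample analog `θ̂₀` computed from outcome data `y` and assignment `d`. -/
def thetaHat0 {N T : ℕ} (𝒢 : Finset Date) (Ng : Date → ℕ) (a : Fin T → Date → Date → ℝ)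
    (y : Fin N → Fin T → ℝ) (d : Fin N → 𝒢) : ℝ :=
  ∑ t, ∑ g ∈ 𝒢, ∑ g' ∈ 𝒢, a t g g' * (cmean Ng y d g t - cmean Ng y d g' t)

/-- The statistic `X̂` computed from outcome data `y` and assignment `d`. -/
def Xhat {N T M : ℕ} (𝒢 : Finset Date) (Ng : Date → ℕ)
    (b : Fin M → Fin T → Date → Date → ℝ) (y : Fin N → Fin T → ℝ) (d : Fin N → 𝒢) :
    Fin M → ℝ :=
  fun j => ∑ t, ∑ g ∈ 𝒢, ∑ g' ∈ 𝒢, b j t g g' * (cmean Ng y d g t - cmean Ng y d g' t)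

/-- Induced row vector `A_{θ,g}` of weights on `Ȳ_g` in `θ̂₀`. -/
def Atheta (T : ℕ) (𝒢 : Finset Date) (a : Fin T → Date → Date → ℝ) (g : Date) :
    Fin T → ℝ := fun t => ∑ g' ∈ 𝒢, (a t g g' - a t g' g)

/-- Induced `M × T` matrix `A_{0,g}` of weights on `Ȳ_g` in `X̂`. -/
def A0 (T M : ℕ) (𝒢 : Finset Date) (b : Fin M → Fin T → Date → Date → ℝ) (g : Date) :
    Matrix (Fin M) (Fin T) ℝ :=
  Matrix.of fun j t => ∑ g' ∈ 𝒢, (b j t g g' - b j t g' g)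

/-- `S_θ`: finite-population variance of the unit-level scalars `Σ_g A_{θ,g} Y_i(g)`. -/
def Stheta (N T : ℕ) (𝒢 : Finset Date) (Y : Fin N → Date → Fin T → ℝ)
    (a : Fin T → Date → Date → ℝ) : ℝ :=
  popVarS N fun i => ∑ g ∈ 𝒢, Atheta T 𝒢 a g ⬝ᵥ Y i g

/-- Within-cohort sample covariance `Ŝ_g` from outcome data `y` and assignment `d`. -/
def Shat {N T : ℕ} {𝒢 : Finset Date} (Ng : Date → ℕ) (y : Fin N → Fin T → ℝ)
    (d : Fin N → 𝒢) (g : Date) : Matrix (Fin T) (Fin T) ℝ :=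
  Matrix.of fun t t' =>
    (∑ i, if (d i : Date) = g then
      (y i t - cmean Ng y d g t) * (y i t' - cmean Ng y d g t') else 0) / ((Ng g : ℝ) - 1)

/-- Plug-in estimate `V̂_{X̂}`. -/
def VhatX {N T M : ℕ} (𝒢 : Finset Date) (Ng : Date → ℕ)
    (b : Fin M → Fin T → Date → Date → ℝ) (y : Fin N → Fin T → ℝ) (d : Fin N → 𝒢) :
    Matrix (Fin M) (Fin M) ℝ :=
  ∑ g ∈ 𝒢, ((Ng g : ℝ))⁻¹ • (A0 T M 𝒢 b g * Shat Ng y d g * (A0 T M 𝒢 b g)ᵀ)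

/-- Plug-in estimate `V̂_{X̂,θ̂₀}`. -/
def VhatXtheta {N T M : ℕ} (𝒢 : Finset Date) (Ng : Date → ℕ)
    (a : Fin T → Date → Date → ℝ) (b : Fin M → Fin T → Date → Date → ℝ)
    (y : Fin N → Fin T → ℝ) (d : Fin N → 𝒢) : Fin M → ℝ :=
  ∑ g ∈ 𝒢, ((Ng g : ℝ))⁻¹ • ((A0 T M 𝒢 b g * Shat Ng y d g).mulVec (Atheta T 𝒢 a g))

/-- Plug-in coefficient `β̂* = V̂_{X̂}⁻¹ V̂_{X̂,θ̂₀}`. -/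
def betaHatStar {N T M : ℕ} (𝒢 : Finset Date) (Ng : Date → ℕ)
    (a : Fin T → Date → Date → ℝ) (b : Fin M → Fin T → Date → Date → ℝ)
    (y : Fin N → Fin T → ℝ) (d : Fin N → 𝒢) : Fin M → ℝ :=
  (VhatX 𝒢 Ng b y d)⁻¹.mulVec (VhatXtheta 𝒢 Ng a b y d)

/-- Plug-in efficient estimator `θ̂_{β̂*} = θ̂₀ - X̂'β̂*`. -/
def thetaHatPlug {N T M : ℕ} (𝒢 : Finset Date) (Ng : Date → ℕ)
    (a : Fin T → Date → Date → ℝ) (b : Fin M → Fin T → Date → Date → ℝ)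
    (y : Fin N → Fin T → ℝ) (d : Fin N → 𝒢) : ℝ :=
  thetaHat0 𝒢 Ng a y d - ∑ j, Xhat 𝒢 Ng b y d j * betaHatStar 𝒢 Ng a b y d j

/-- Neyman-style variance estimator `σ̂*²`. -/
def sigmaSqNeyman {N T M : ℕ} (𝒢 : Finset Date) (Ng : Date → ℕ)
    (a : Fin T → Date → Date → ℝ) (b : Fin M → Fin T → Date → Date → ℝ)
    (y : Fin N → Fin T → ℝ) (d : Fin N → 𝒢) : ℝ :=
  (∑ g ∈ 𝒢, ((N : ℝ) / (Ng g : ℝ)) *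
      (Atheta T 𝒢 a g ⬝ᵥ (Shat Ng y d g).mulVec (Atheta T 𝒢 a g)))
  - (∑ g ∈ 𝒢, ((N : ℝ) / (Ng g : ℝ)) •
        ((A0 T M 𝒢 b g * Shat Ng y d g).mulVec (Atheta T 𝒢 a g))) ⬝ᵥ
    ((∑ g ∈ 𝒢, ((N : ℝ) / (Ng g : ℝ)) •
        (A0 T M 𝒢 b g * Shat Ng y d g * (A0 T M 𝒢 b g)ᵀ))⁻¹.mulVec
      (∑ g ∈ 𝒢, ((N : ℝ) / (Ng g : ℝ)) •
        ((A0 T M 𝒢 b g * Shat Ng y d g).mulVec (Atheta T 𝒢 a g))))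

/-- The `(g_min - 1) × T` selection matrix `M` picking out the periods before `g_min`. -/
def Msel (T gmin : ℕ) : Matrix (Fin (gmin - 1)) (Fin T) ℝ :=
  Matrix.of fun k t => if (t : ℕ) = (k : ℕ) then 1 else 0

/-- `β̂_g = (M Ŝ_g M')⁻¹ M Ŝ_g A_{θ,g}'`. -/
def betaHatg {N T : ℕ} {𝒢 : Finset Date} (Ng : Date → ℕ) (a : Fin T → Date → Date → ℝ)
    (gmin : ℕ) (y : Fin N → Fin T → ℝ) (d : Fin N → 𝒢) (g : Date) : Fin (gmin - 1) → ℝ :=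
  (Msel T gmin * Shat Ng y d g * (Msel T gmin)ᵀ)⁻¹.mulVec
    ((Msel T gmin * Shat Ng y d g).mulVec (Atheta T 𝒢 a g))

/-- Refined variance estimator `σ̂**²`. -/
def sigmaSqRefined {N T M : ℕ} (𝒢 : Finset Date) (Ng : Date → ℕ)
    (a : Fin T → Date → Date → ℝ) (b : Fin M → Fin T → Date → Date → ℝ) (gmin : ℕ)
    (y : Fin N → Fin T → ℝ) (d : Fin N → 𝒢) : ℝ :=
  sigmaSqNeyman 𝒢 Ng a b y d -
    (∑ g ∈ 𝒢.filter fun g => (gmin : Date) ≤ g, betaHatg Ng a gmin y d g) ⬝ᵥ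
      ((Msel T gmin * Shat Ng y d (gmin : Date) * (Msel T gmin)ᵀ).mulVec
        (∑ g ∈ 𝒢.filter fun g => (gmin : Date) ≤ g, betaHatg Ng a gmin y d g))

/-- Studentized plug-in efficient statistic `t = θ̂_{β̂*} / (σ̂** / √N)`. -/
def tstat {N T M : ℕ} (𝒢 : Finset Date) (Ng : Date → ℕ)
    (a : Fin T → Date → Date → ℝ) (b : Fin M → Fin T → Date → Date → ℝ) (gmin : ℕ)
    (y : Fin N → Fin T → ℝ) (d : Fin N → 𝒢) : ℝ :=
  thetaHatPlug 𝒢 Ng a b y d /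
    (Real.sqrt (sigmaSqRefined 𝒢 Ng a b gmin y d) / Real.sqrt (N : ℝ))

/-- Fisher randomization test p-value for the statistic `stat`, based on observed data
`(Y(G), G)` and recomputing the statistic with permuted assignments. -/
def pFRT {N T : ℕ} {𝒢 : Finset Date} (stat : (Fin N → Fin T → ℝ) → (Fin N → 𝒢) → ℝ)
    (Y : Fin N → Date → Fin T → ℝ) (d : Fin N → 𝒢) : ℝ :=
  (((Finset.univ : Finset (Equiv.Perm (Fin N))).filter fun π =>
      stat (obs Y d) (fun i => d (π i)) ≥ stat (obs Y d) d).card : ℝ) /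
    ((Finset.univ : Finset (Equiv.Perm (Fin N))).card : ℝ)

/-- Limit covariance matrix `V*_{X̂}`. -/
def VstarX (T M : ℕ) (𝒢 : Finset Date) (b : Fin M → Fin T → Date → Date → ℝ)
    (p : Date → ℝ) (Sstar : Date → Matrix (Fin T) (Fin T) ℝ) : Matrix (Fin M) (Fin M) ℝ :=
  ∑ g ∈ 𝒢, (p g)⁻¹ • (A0 T M 𝒢 b g * Sstar g * (A0 T M 𝒢 b g)ᵀ)

/-- Limit covariance vector `V*_{X̂,θ̂₀}`. -/
def VstarXtheta (T M : ℕ) (𝒢 : Finset Date) (a : Fin T → Date → Date → ℝ)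
    (b : Fin M → Fin T → Date → Date → ℝ) (p : Date → ℝ)
    (Sstar : Date → Matrix (Fin T) (Fin T) ℝ) : Fin M → ℝ :=
  ∑ g ∈ 𝒢, (p g)⁻¹ • ((A0 T M 𝒢 b g * Sstar g).mulVec (Atheta T 𝒢 a g))

/-- Limit variance `V*_{θ̂₀}`. -/
def VstarTheta (T : ℕ) (𝒢 : Finset Date) (a : Fin T → Date → Date → ℝ) (p : Date → ℝ)
    (Sstar : Date → Matrix (Fin T) (Fin T) ℝ) (Sthetastar : ℝ) : ℝ :=
  (∑ g ∈ 𝒢, (p g)⁻¹ * (Atheta T 𝒢 a g ⬝ᵥ (Sstar g).mulVec (Atheta T 𝒢 a g))) - Sthetastar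

/-- Asymptotic variance `σ*²` of the (plug-in) efficient estimator. -/
def sigmaSqLim (T M : ℕ) (𝒢 : Finset Date) (a : Fin T → Date → Date → ℝ)
    (b : Fin M → Fin T → Date → Date → ℝ) (p : Date → ℝ)
    (Sstar : Date → Matrix (Fin T) (Fin T) ℝ) (Sthetastar : ℝ) : ℝ :=
  VstarTheta T 𝒢 a p Sstar Sthetastar -
    VstarXtheta T M 𝒢 a b p Sstar ⬝ᵥ
      (VstarX T M 𝒢 b p Sstar)⁻¹.mulVec (VstarXtheta T M 𝒢 a b p Sstar)

/-- A bounded real function. -/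
def IsBounded (f : ℝ → ℝ) : Prop := ∃ C, ∀ x, |f x| ≤ C

end Staggered

namespace Staggered

/-! ### Basic properties of the design expectation -/

/-- The complex-valued expectation. -/
def EC (N : ℕ) (𝒢 : Finset Date) (Ng : Date → ℕ) (f : (Fin N → 𝒢) → ℂ) : ℂ :=
  (∑ d ∈ assigns N 𝒢 Ng, f d) / ((assigns N 𝒢 Ng).card : ℂ)

/-- Cohort sum of a scalar attribute. -/
def Lin {N : ℕ} {𝒢 : Finset Date} (g : Date) (x : Fin N → ℝ) (d : Fin N → 𝒢) : ℝ :=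
  ∑ i, if (d i : Date) = g then x i else 0

section basic

variable {N : ℕ} {𝒢 : Finset Date} {Ng : Date → ℕ}

lemma mem_assigns {d : Fin N → 𝒢} : d ∈ assigns N 𝒢 Ng ↔
    ∀ g ∈ 𝒢, (Finset.univ.filter fun i => (d i : Date) = g).card = Ng g := by
  simp [assigns]

lemma assigns_nonempty (hsum : ∑ g ∈ 𝒢, Ng g = N) : (assigns N 𝒢 Ng).Nonempty := by
  have hc : Fintype.card (Fin N) = Fintype.card (Σ g : 𝒢, Fin (Ng g)) := by
    simp only [Fintype.card_fin, Fintype.card_sigma]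
    rw [← hsum, ← Finset.sum_coe_sort 𝒢]
  let e := Fintype.equivOfCardEq hc
  refine ⟨fun i => (e i).1, ?_⟩
  rw [mem_assigns]
  intro g hg
  have : (Finset.univ.filter fun i => (((e i).1 : 𝒢) : Date) = g).card
      = (Finset.univ : Finset (Fin (Ng g))).card := by
    symm
    apply Finset.card_bij (fun k _ => e.symm ⟨⟨g, hg⟩, k⟩)
    · intro k _; simp
    · intro k _ k' _ h
      have := e.symm.injective h
      simpa using this
    · intro i hi
      simp only [Finset.mem_filter, Finset.mem_univ, true_and] at hi
      subst hi
      exact ⟨(e i).2, Finset.mem_univ _, by simp⟩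
  simpa using this

lemma assigns_comp (σ : Equiv.Perm (Fin N)) {d : Fin N → 𝒢} :
    (fun i => d (σ i)) ∈ assigns N 𝒢 Ng ↔ d ∈ assigns N 𝒢 Ng := by
  rw [mem_assigns, mem_assigns]
  refine forall₂_congr fun g hg => ?_
  have : (Finset.univ.filter fun i => (d (σ i) : Date) = g).card =
    (Finset.univ.filter fun i => (d i : Date) = g).card := by
    apply Finset.card_bij (fun i _ => σ i)
    · intro i hi; simpa using hi
    · intro i _ j _ h; exact σ.injective h
    · intro i hi
      exact ⟨σ.symm i, by simpa using hi, by simp⟩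
  rw [this]

lemma sum_assigns_comp {R : Type*} [AddCommMonoid R] (σ : Equiv.Perm (Fin N))
    (f : (Fin N → 𝒢) → R) :
    ∑ d ∈ assigns N 𝒢 Ng, f (fun i => d (σ i)) = ∑ d ∈ assigns N 𝒢 Ng, f d := by
  refine Finset.sum_bij (fun d _ => fun i => d (σ i)) ?_ ?_ ?_ ?_
  · intro d hd; exact (assigns_comp σ).2 hd
  · intro d _ d' _ h
    funext i
    have := congrFun h (σ.symm i)
    simpa using this
  · intro d hd
    refine ⟨fun i => d (σ.symm i), (assigns_comp σ.symm).2 hd, ?_⟩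
    funext i; simp
  · intro d _; rfl

lemma expec_comp (σ : Equiv.Perm (Fin N)) (f : (Fin N → 𝒢) → ℝ) :
    expec N 𝒢 Ng (fun d => f (fun i => d (σ i))) = expec N 𝒢 Ng f := by
  unfold expec; rw [sum_assigns_comp]

lemma EC_comp (σ : Equiv.Perm (Fin N)) (f : (Fin N → 𝒢) → ℂ) :
    EC N 𝒢 Ng (fun d => f (fun i => d (σ i))) = EC N 𝒢 Ng f := by
  unfold EC; rw [sum_assigns_comp]

lemma expec_add (f h : (Fin N → 𝒢) → ℝ) :
    expec N 𝒢 Ng (fun d => f d + h d) = expec N 𝒢 Ng f + expec N 𝒢 Ng h := by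
  unfold expec; rw [Finset.sum_add_distrib, add_div]

lemma expec_sub (f h : (Fin N → 𝒢) → ℝ) :
    expec N 𝒢 Ng (fun d => f d - h d) = expec N 𝒢 Ng f - expec N 𝒢 Ng h := by
  unfold expec; rw [Finset.sum_sub_distrib, sub_div]

lemma expec_const_mul (c : ℝ) (f : (Fin N → 𝒢) → ℝ) :
    expec N 𝒢 Ng (fun d => c * f d) = c * expec N 𝒢 Ng f := by
  unfold expec; rw [← Finset.mul_sum, mul_div_assoc]

lemma expec_sum {ι : Type*} (s : Finset ι) (f : ι → (Fin N → 𝒢) → ℝ) :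
    expec N 𝒢 Ng (fun d => ∑ i ∈ s, f i d) = ∑ i ∈ s, expec N 𝒢 Ng (f i) := by
  unfold expec; rw [Finset.sum_comm, Finset.sum_div]

lemma expec_congr {f h : (Fin N → 𝒢) → ℝ} (H : ∀ d ∈ assigns N 𝒢 Ng, f d = h d) :
    expec N 𝒢 Ng f = expec N 𝒢 Ng h := by
  unfold expec; rw [Finset.sum_congr rfl H]

lemma expec_mono {f h : (Fin N → 𝒢) → ℝ} (H : ∀ d ∈ assigns N 𝒢 Ng, f d ≤ h d) :
    expec N 𝒢 Ng f ≤ expec N 𝒢 Ng h := by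
  unfold expec; exact div_le_div_of_nonneg_right (Finset.sum_le_sum H) (by positivity)

lemma expec_nonneg {f : (Fin N → 𝒢) → ℝ} (H : ∀ d ∈ assigns N 𝒢 Ng, 0 ≤ f d) :
    0 ≤ expec N 𝒢 Ng f := by
  unfold expec; exact div_nonneg (Finset.sum_nonneg H) (by positivity)

lemma expec_const (hsum : ∑ g ∈ 𝒢, Ng g = N) (c : ℝ) :
    expec N 𝒢 Ng (fun _ => c) = c := by
  have := (assigns_nonempty hsum).card_pos
  unfold expec; rw [Finset.sum_const, nsmul_eq_mul]; field_simp

lemma EC_add (f h : (Fin N → 𝒢) → ℂ) :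
    EC N 𝒢 Ng (fun d => f d + h d) = EC N 𝒢 Ng f + EC N 𝒢 Ng h := by
  unfold EC; rw [Finset.sum_add_distrib, add_div]

lemma EC_sub (f h : (Fin N → 𝒢) → ℂ) :
    EC N 𝒢 Ng (fun d => f d - h d) = EC N 𝒢 Ng f - EC N 𝒢 Ng h := by
  unfold EC; rw [Finset.sum_sub_distrib, sub_div]

lemma EC_const_mul (c : ℂ) (f : (Fin N → 𝒢) → ℂ) :
    EC N 𝒢 Ng (fun d => c * f d) = c * EC N 𝒢 Ng f := by
  unfold EC; rw [← Finset.mul_sum, mul_div_assoc]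

lemma EC_sum {ι : Type*} (s : Finset ι) (f : ι → (Fin N → 𝒢) → ℂ) :
    EC N 𝒢 Ng (fun d => ∑ i ∈ s, f i d) = ∑ i ∈ s, EC N 𝒢 Ng (f i) := by
  unfold EC; rw [Finset.sum_comm, Finset.sum_div]

lemma EC_congr {f h : (Fin N → 𝒢) → ℂ} (H : ∀ d ∈ assigns N 𝒢 Ng, f d = h d) :
    EC N 𝒢 Ng f = EC N 𝒢 Ng h := by
  unfold EC; rw [Finset.sum_congr rfl H]

lemma norm_EC_le (f : (Fin N → 𝒢) → ℂ) {h : (Fin N → 𝒢) → ℝ} (H : ∀ d, ‖f d‖ ≤ h d) :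
    ‖EC N 𝒢 Ng f‖ ≤ expec N 𝒢 Ng h := by
  unfold EC expec
  rw [norm_div, Complex.norm_natCast]
  exact div_le_div_of_nonneg_right ((norm_sum_le _ _).trans (Finset.sum_le_sum fun d _ => H d))
    (by positivity)

/-- `(E|f|)² ≤ E f²`. -/
lemma expec_abs_le_sqrt (hsum : ∑ g ∈ 𝒢, Ng g = N) (f : (Fin N → 𝒢) → ℝ) :
    expec N 𝒢 Ng (fun d => |f d|) ≤ Real.sqrt (expec N 𝒢 Ng (fun d => f d ^ 2)) := by
  apply Real.le_sqrt_of_sq_le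
  set c := expec N 𝒢 Ng (fun d => |f d|) with hc
  have h0 : 0 ≤ expec N 𝒢 Ng (fun d => (|f d| - c) ^ 2) := expec_nonneg fun d _ => sq_nonneg _
  have h1 : expec N 𝒢 Ng (fun d => (|f d| - c) ^ 2) =
      expec N 𝒢 Ng (fun d => f d ^ 2) - 2 * c * c + c ^ 2 := by
    have : (fun d => (|f d| - c) ^ 2) = fun d => (f d ^ 2 - (2 * c) * |f d|) + c ^ 2 := by
      funext d; rw [← sq_abs (f d)]; ring
    rw [this, expec_add, expec_sub, expec_const_mul, expec_const hsum]
  nlinarith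

lemma sum_ind {d : Fin N → 𝒢} (hd : d ∈ assigns N 𝒢 Ng) {g : Date} (hg : g ∈ 𝒢) :
    ∑ i, (if (d i : Date) = g then (1 : ℝ) else 0) = Ng g := by
  rw [Finset.sum_boole, mem_assigns.1 hd g hg]

/-- first moment of a cohort indicator -/
lemma expec_ind (hN : 0 < N) (hsum : ∑ g ∈ 𝒢, Ng g = N) {g : Date} (hg : g ∈ 𝒢) (i : Fin N) :
    expec N 𝒢 Ng (fun d => if (d i : Date) = g then (1 : ℝ) else 0) = Ng g / N := by
  have hs : ∀ j, expec N 𝒢 Ng (fun d => if (d j : Date) = g then (1 : ℝ) else 0) =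
      expec N 𝒢 Ng (fun d => if (d i : Date) = g then (1 : ℝ) else 0) := by
    intro j
    rw [← expec_comp (Equiv.swap i j) (fun d => if (d i : Date) = g then (1 : ℝ) else 0)]
    simp
  have h1 : ∑ j, expec N 𝒢 Ng (fun d => if (d j : Date) = g then (1 : ℝ) else 0) = Ng g := by
    rw [← expec_sum, expec_congr (h := fun _ => (Ng g : ℝ)) fun d hd => sum_ind hd hg,
      expec_const hsum]
  rw [Finset.sum_congr rfl fun j _ => hs j] at h1
  rw [Finset.sum_const, Finset.card_univ, Fintype.card_fin, nsmul_eq_mul] at h1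
  have : (0 : ℝ) < N := by exact_mod_cast hN
  field_simp
  linarith

lemma Lin_eq (g : Date) (x : Fin N → ℝ) (d : Fin N → 𝒢) :
    Lin g x d = ∑ i, x i * (if (d i : Date) = g then (1 : ℝ) else 0) := by
  unfold Lin
  exact Finset.sum_congr rfl fun i _ => by split_ifs <;> simp

lemma expec_Lin (hN : 0 < N) (hsum : ∑ g ∈ 𝒢, Ng g = N) {g : Date} (hg : g ∈ 𝒢)
    (x : Fin N → ℝ) : expec N 𝒢 Ng (Lin g x) = Ng g / N * ∑ i, x i := by
  have : (Lin g x : (Fin N → 𝒢) → ℝ) =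
      fun d => ∑ i, x i * (if (d i : Date) = g then (1 : ℝ) else 0) := by
    funext d; rw [Lin_eq]
  rw [this, expec_sum, Finset.mul_sum]
  refine Finset.sum_congr rfl fun i _ => ?_
  rw [expec_const_mul, expec_ind hN hsum hg, mul_comm]

lemma exists_perm {i j k l : Fin N} (hij : i ≠ j) (hkl : k ≠ l) :
    ∃ σ : Equiv.Perm (Fin N), σ i = k ∧ σ j = l := by
  refine ⟨Equiv.swap (Equiv.swap i k j) l * Equiv.swap i k, ?_, ?_⟩
  · simp only [Equiv.Perm.mul_apply, Equiv.swap_apply_left]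
    apply Equiv.swap_apply_of_ne_of_ne _ hkl
    intro h
    have := congrArg (Equiv.swap i k) h
    simp at this
    exact hij this
  · simp

/-- Exact second moments of cohort sums of centred attributes. -/
lemma expec_Lin_mul (hN : 2 ≤ N) (hsum : ∑ g ∈ 𝒢, Ng g = N) {g h : Date} (hg : g ∈ 𝒢)
    (hh : h ∈ 𝒢) (x y : Fin N → ℝ) (hx : ∑ i, x i = 0) (_hy : ∑ i, y i = 0) :
    expec N 𝒢 Ng (fun d => Lin g x d * Lin h y d) =
      ((if g = h then (Ng g : ℝ) else 0) - Ng g * Ng h / N) * ((∑ i, x i * y i) / (N - 1)) := by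
  set e : Fin N → Fin N → ℝ := fun i j => expec N 𝒢 Ng (fun d =>
    (if (d i : Date) = g then (1 : ℝ) else 0) * (if (d j : Date) = h then (1 : ℝ) else 0)) with he
  let i0 : Fin N := ⟨0, by omega⟩
  let i1 : Fin N := ⟨1, by omega⟩
  have hne : i0 ≠ i1 := by simp [i0, i1]
  have hNpos : (0 : ℝ) < N := by exact_mod_cast (by omega : 0 < N)
  have hN1 : (0 : ℝ) < (N : ℝ) - 1 := by
    have : (2 : ℝ) ≤ N := by exact_mod_cast hN
    linarith
  set c := e i0 i1 with hc
  set q : ℝ := if g = h then (Ng g : ℝ) / N else 0 with hq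
  have hoff : ∀ i j, i ≠ j → e i j = c := by
    intro i j hij
    obtain ⟨σ, h1, h2⟩ := exists_perm hne hij
    rw [hc, he]
    simp only
    rw [← expec_comp σ (fun d => (if (d i0 : Date) = g then (1 : ℝ) else 0) *
      (if (d i1 : Date) = h then (1 : ℝ) else 0))]
    simp only [h1, h2]
  have hdiag : ∀ i, e i i = q := by
    intro i
    rw [he, hq]
    simp only
    split_ifs with hgh
    · subst hgh
      rw [← expec_ind (by omega) hsum hg i]
      congr 1; funext d; split_ifs <;> simp
    · refine Eq.trans (b := expec N 𝒢 Ng (fun _ => (0 : ℝ))) ?_ (expec_const hsum 0)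
      congr 1; funext d
      by_cases h1 : (d i : Date) = g
      · have : ¬ (d i : Date) = h := by rw [h1]; exact hgh
        simp [this]
      · simp [h1]
  have heij : ∀ i j, e i j = c + (q - c) * (if i = j then 1 else 0) := by
    intro i j
    by_cases hij : i = j
    · subst hij; rw [hdiag]; simp
    · rw [hoff i j hij]; simp [hij]
  have htot : ∑ i, ∑ j, e i j = Ng g * Ng h := by
    rw [he]
    simp only
    simp_rw [← expec_sum]
    rw [expec_congr (h := fun _ => (Ng g : ℝ) * Ng h), expec_const hsum]
    intro d hd
    rw [← Finset.sum_mul_sum, sum_ind hd hg, sum_ind hd hh]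
  have htot2 : ∑ i : Fin N, ∑ j : Fin N, e i j = N * (N * c) + N * (q - c) := by
    simp_rw [heij]
    simp [Finset.sum_add_distrib, mul_sub]
  have hmain : expec N 𝒢 Ng (fun d => Lin g x d * Lin h y d) = (q - c) * ∑ i, x i * y i := by
    have : (fun d : Fin N → 𝒢 => Lin g x d * Lin h y d) = fun d => ∑ i, ∑ j, (x i * y j) *
        ((if (d i : Date) = g then (1 : ℝ) else 0) * (if (d j : Date) = h then (1 : ℝ) else 0)) := by
      funext d
      rw [Lin_eq, Lin_eq, Finset.sum_mul_sum]
      exact Finset.sum_congr rfl fun i _ => Finset.sum_congr rfl fun j _ => by ring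
    rw [this]
    simp_rw [expec_sum, expec_const_mul]
    have : ∀ i j, x i * y j * e i j = c * (x i * y j) +
        (q - c) * (if i = j then x i * y j else 0) := by
      intro i j; rw [heij]; split_ifs <;> ring
    calc ∑ i, ∑ j, x i * y j * e i j = c * ((∑ i, x i) * ∑ j, y j) +
        (q - c) * ∑ i, x i * y i := by
          simp_rw [this, Finset.sum_add_distrib, ← Finset.mul_sum, Finset.sum_mul_sum]
          simp [Finset.mul_sum]
      _ = _ := by rw [hx]; ring
  rw [hmain]
  rw [htot] at htot2
  have hqq : (if g = h then (Ng g : ℝ) else 0) = N * q := by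
    rw [hq]; split_ifs
    · field_simp
    · simp
  rw [hqq]
  have : q - c = (N * q - Ng g * Ng h / N) / (N - 1) := by
    rw [htot2]; field_simp; ring
  rw [this]; ring

/-- Crude second-moment bound. -/
lemma expec_Lin_sq_le (hN : 2 ≤ N) (hNg : ∀ g ∈ 𝒢, 1 ≤ Ng g) (hsum : ∑ g ∈ 𝒢, Ng g = N)
    {g : Date} (hg : g ∈ 𝒢)
    (x : Fin N → ℝ) (hx : ∑ i, x i = 0) :
    expec N 𝒢 Ng (fun d => Lin g x d ^ 2) ≤ ∑ i, x i ^ 2 := by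
  have hNpos : (2 : ℝ) ≤ N := by exact_mod_cast hN
  have h1 : (1 : ℝ) ≤ Ng g := by exact_mod_cast hNg g hg
  have h2 : (Ng g : ℝ) ≤ N := by
    rw [← hsum]; exact_mod_cast Finset.single_le_sum (f := Ng) (fun _ _ => Nat.zero_le _) hg
  have := expec_Lin_mul hN hsum hg hg x x hx hx
  simp only [← sq] at this
  rw [this]
  have hs : 0 ≤ ∑ i, x i ^ 2 := Finset.sum_nonneg fun i _ => sq_nonneg _
  simp only [if_true]
  rw [← mul_div_assoc, div_le_iff₀ (by linarith), mul_comm]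
  apply mul_le_mul_of_nonneg_left _ hs
  rw [sub_le_iff_le_add, ← sub_le_iff_le_add', le_div_iff₀ (by linarith)]
  nlinarith

end basic

end Staggered

namespace Staggered

/-! ### A combinatorial central limit theorem through exchangeable pairs -/

section clt

variable {N : ℕ} {𝒢 : Finset Date} {Ng : Date → ℕ}

/-- The linear statistic `Σ_i v_i(G_i)`. -/
def Wst (v : Fin N → Date → ℝ) (d : Fin N → 𝒢) : ℝ := ∑ i, v i (d i)

/-- Increment of `Wst` under a transposition. -/
def Dl (v : Fin N → Date → ℝ) (i j : Fin N) (d : Fin N → 𝒢) : ℝ :=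
  v i (d j) + v j (d i) - v i (d i) - v j (d j)

/-- Normalized sum of squared increments. -/
def Bst (v : Fin N → Date → ℝ) (d : Fin N → 𝒢) : ℝ := (∑ i, ∑ j, Dl v i j d ^ 2) / (4 * N)

lemma Wst_swap (v : Fin N → Date → ℝ) (i j : Fin N) (d : Fin N → 𝒢) :
    Wst v (fun k => d (Equiv.swap i j k)) = Wst v d + Dl v i j d := by
  by_cases hij : i = j
  · subst hij; simp [Wst, Dl]
  · have h : ∑ k, (v k (d (Equiv.swap i j k)) - v k (d k)) = Dl v i j d := by
      rw [Fintype.sum_eq_add i j hij]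
      · simp [Dl]; ring
      · rintro k ⟨h1, h2⟩
        rw [Equiv.swap_apply_of_ne_of_ne h1 h2]; simp
    rw [Finset.sum_sub_distrib] at h
    unfold Wst; linarith

lemma Dl_swap (v : Fin N → Date → ℝ) (i j : Fin N) (d : Fin N → 𝒢) :
    Dl v i j (fun k => d (Equiv.swap i j k)) = - Dl v i j d := by
  simp [Dl]; ring

lemma sum_cohort {d : Fin N → 𝒢} (hd : d ∈ assigns N 𝒢 Ng) (f : Date → ℝ) :
    ∑ j, f (d j) = ∑ g ∈ 𝒢, Ng g * f g := by
  have h1 : ∀ j, f (d j) = ∑ g ∈ 𝒢, if (d j : Date) = g then f g else 0 := by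
    intro j
    rw [Finset.sum_ite_eq]; simp
  simp_rw [h1]
  rw [Finset.sum_comm]
  refine Finset.sum_congr rfl fun g hg => ?_
  rw [← sum_ind hd hg, Finset.sum_mul]
  exact Finset.sum_congr rfl fun i _ => by split_ifs <;> simp

lemma sum_split (f : Fin N → Date → ℝ) (d : Fin N → 𝒢) :
    ∑ i, f i (d i) = ∑ g ∈ 𝒢, Lin g (fun i => f i g) d := by
  unfold Lin
  rw [Finset.sum_comm]
  refine Finset.sum_congr rfl fun i _ => ?_
  rw [Finset.sum_ite_eq]; simp

variable (v : Fin N → Date → ℝ)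

lemma sum_Dl (hrow : ∀ i, ∑ g ∈ 𝒢, Ng g * v i g = 0) {d : Fin N → 𝒢}
    (hd : d ∈ assigns N 𝒢 Ng) : ∑ i, ∑ j, Dl v i j d = - (2 * N * Wst v d) := by
  have h1 : ∑ i, ∑ j, v i (d j) = 0 := by
    refine Finset.sum_eq_zero fun i _ => ?_
    rw [sum_cohort hd (v i), hrow]
  have h2 : ∑ i, ∑ j, v j (d i) = 0 := by rw [Finset.sum_comm]; exact h1
  have h3 : ∑ i, ∑ j : Fin N, v i (d i) = N * Wst v d := by
    simp [Wst, Finset.mul_sum]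
  have h4 : ∑ i : Fin N, ∑ j, v j (d j) = N * Wst v d := by
    simp [Wst]
  unfold Dl
  simp only [Finset.sum_sub_distrib, Finset.sum_add_distrib]
  rw [h1, h2, h3, h4]; ring

lemma sum_Dl_sq (hrow : ∀ i, ∑ g ∈ 𝒢, Ng g * v i g = 0) (hcol : ∀ g ∈ 𝒢, ∑ i, v i g = 0)
    {d : Fin N → 𝒢} (hd : d ∈ assigns N 𝒢 Ng) :
    ∑ i, ∑ j, Dl v i j d ^ 2 = 2 * (∑ i, ∑ g ∈ 𝒢, Ng g * v i g ^ 2)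
      + 2 * N * (∑ i, v i (d i) ^ 2) + 2 * Wst v d ^ 2
      + 2 * ∑ g ∈ 𝒢, ∑ h ∈ 𝒢, Lin g (fun i => v i h) d * Lin h (fun i => v i g) d := by
  have e : ∀ i j, Dl v i j d ^ 2 = v i (d j) ^ 2 + v j (d i) ^ 2 + v i (d i) ^ 2 + v j (d j) ^ 2
      + 2 * (v i (d j) * v j (d i)) - 2 * (v i (d j) * v i (d i)) - 2 * (v i (d j) * v j (d j))
      - 2 * (v j (d i) * v i (d i)) - 2 * (v j (d i) * v j (d j))
      + 2 * (v i (d i) * v j (d j)) := by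
    intro i j; unfold Dl; ring
  simp_rw [e]
  simp only [Finset.sum_sub_distrib, Finset.sum_add_distrib, ← Finset.mul_sum]
  have h1 : ∑ i, ∑ j, v i (d j) ^ 2 = ∑ i, ∑ g ∈ 𝒢, Ng g * v i g ^ 2 :=
    Finset.sum_congr rfl fun i _ => sum_cohort hd (fun g => v i g ^ 2)
  have h2 : ∑ i, ∑ j, v j (d i) ^ 2 = ∑ i, ∑ g ∈ 𝒢, Ng g * v i g ^ 2 := by
    rw [Finset.sum_comm]; exact h1
  have h3 : ∑ i, ∑ j : Fin N, v i (d i) ^ 2 = N * ∑ i, v i (d i) ^ 2 := by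
    simp [Finset.mul_sum]
  have h4 : ∑ i : Fin N, ∑ j, v j (d j) ^ 2 = N * ∑ i, v i (d i) ^ 2 := by
    simp
  have h5 : ∑ i, ∑ j, v i (d j) * v i (d i) = 0 := by
    refine Finset.sum_eq_zero fun i _ => ?_
    rw [← Finset.sum_mul, sum_cohort hd (v i), hrow, zero_mul]
  have h6 : ∑ i, v i (d i) * ∑ j, v j (d i) = 0 := by
    refine Finset.sum_eq_zero fun i _ => ?_
    rw [hcol _ (d i).2, mul_zero]
  have h6a : ∑ i, ∑ j, v i (d j) * v j (d j) = 0 := by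
    rw [Finset.sum_comm, ← h6]
    refine Finset.sum_congr rfl fun i _ => ?_
    rw [← Finset.sum_mul, mul_comm]
  have h7 : ∑ i, ∑ j, v j (d i) * v i (d i) = 0 := by
    rw [← h6]
    refine Finset.sum_congr rfl fun i _ => ?_
    rw [← Finset.sum_mul, mul_comm]
  have h8 : ∑ i, ∑ j, v j (d i) * v j (d j) = 0 := by
    rw [Finset.sum_comm]; exact h5
  have h9 : ∑ i, v i (d i) * ∑ j, v j (d j) = Wst v d ^ 2 := by
    rw [← Finset.sum_mul]; unfold Wst; ring
  have h10 : ∑ i, ∑ j, v i (d j) * v j (d i) =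
      ∑ g ∈ 𝒢, ∑ h ∈ 𝒢, Lin g (fun i => v i h) d * Lin h (fun i => v i g) d := by
    calc ∑ i, ∑ j, v i (d j) * v j (d i)
        = ∑ i, ∑ g ∈ 𝒢, ∑ j, ∑ h ∈ 𝒢, (if (d i : Date) = g then v i h else 0) *
            (if (d j : Date) = h then v j g else 0) := by
          refine Finset.sum_congr rfl fun i _ => ?_
          rw [Finset.sum_eq_single_of_mem (d i : Date) (d i).2]
          · refine Finset.sum_congr rfl fun j _ => ?_
            rw [Finset.sum_eq_single_of_mem (d j : Date) (d j).2]
            · simp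
            · intro h _ hne; simp [Ne.symm hne]
          · intro g _ hne; simp [Ne.symm hne]
      _ = _ := by
          rw [Finset.sum_comm]
          refine Finset.sum_congr rfl fun g _ => ?_
          simp_rw [Finset.sum_comm (s := (Finset.univ : Finset (Fin N))) (t := 𝒢)]
          refine Finset.sum_congr rfl fun h _ => ?_
          unfold Lin
          rw [Finset.sum_mul_sum]
  rw [h1, h2, h3, h4, h5, h6a, h7, h8, h9, h10]
  ring

lemma norm_exp_I_sub_le (x : ℝ) : ‖Complex.exp (Complex.I * x) - 1 - Complex.I * x‖ ≤ 3 * x ^ 2 := by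
  have hn : ‖Complex.I * (x : ℂ)‖ = |x| := by simp
  by_cases h : |x| ≤ 1
  · refine (Complex.norm_exp_sub_one_sub_id_le (by rw [hn]; exact h)).trans ?_
    rw [hn, sq_abs]; nlinarith [sq_nonneg x]
  · push Not at h
    refine (norm_sub_le _ _).trans ?_
    rw [hn]
    have := Real.norm_exp_I_mul_ofReal_sub_one_le (x := x)
    rw [Real.norm_eq_abs] at this
    rw [← sq_abs]
    nlinarith

/-- The approximate Stein identity for the complex exponential. -/
lemma stein_bound (hN : 0 < N) (hrow : ∀ i, ∑ g ∈ 𝒢, Ng g * v i g = 0)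
    {δ : ℝ} (hδ : ∀ i, ∀ g ∈ 𝒢, |v i g| ≤ δ) (s t : ℝ) :
    ‖EC N 𝒢 Ng (fun d => (Wst v d : ℂ) * Complex.exp (Complex.I * (t * Wst v d : ℝ))) -
      Complex.I * t * s * EC N 𝒢 Ng (fun d => Complex.exp (Complex.I * (t * Wst v d : ℝ)))‖ ≤
    |t| * expec N 𝒢 Ng (fun d => |Bst v d - s|) + 12 * t ^ 2 * δ * expec N 𝒢 Ng (Bst v) := by
  have hNpos : (0 : ℝ) < N := by exact_mod_cast hN
  set e : (Fin N → 𝒢) → ℂ := fun d => Complex.exp (Complex.I * (t * Wst v d : ℝ)) with he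
  have hpair : ∀ i j, EC N 𝒢 Ng (fun d => (Dl v i j d : ℂ) * e d) = - EC N 𝒢 Ng
      (fun d => (Dl v i j d : ℂ) * (e d * Complex.exp (Complex.I * (t * Dl v i j d : ℝ)))) := by
    intro i j
    rw [← EC_comp (Equiv.swap i j)]
    rw [← neg_one_mul, ← EC_const_mul]
    congr 1; funext d
    simp only [he, Dl_swap, Wst_swap]
    rw [← Complex.exp_add]
    push_cast
    ring_nf
  have hsumW : EC N 𝒢 Ng (fun d => (Wst v d : ℂ) * e d) * (4 * N) =
      EC N 𝒢 Ng (fun d => ∑ i, ∑ j, (Dl v i j d : ℂ) * (e d *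
        (Complex.exp (Complex.I * (t * Dl v i j d : ℝ)) - 1))) := by
    have h1 : EC N 𝒢 Ng (fun d => ∑ i, ∑ j, (Dl v i j d : ℂ) * e d) =
        - (2 * N) * EC N 𝒢 Ng (fun d => (Wst v d : ℂ) * e d) := by
      rw [← EC_const_mul]
      apply EC_congr
      intro d hd
      have := congrArg (fun z : ℝ => (z : ℂ)) (sum_Dl v hrow hd)
      push_cast at this
      simp_rw [← Finset.sum_mul]
      rw [this]; ring
    have h2 : EC N 𝒢 Ng (fun d => ∑ i, ∑ j, (Dl v i j d : ℂ) * e d) = - EC N 𝒢 Ng (fun d =>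
        ∑ i, ∑ j, (Dl v i j d : ℂ) * (e d * Complex.exp (Complex.I * (t * Dl v i j d : ℝ)))) := by
      simp_rw [EC_sum, hpair, Finset.sum_neg_distrib]
    have h3 : (fun d : Fin N → 𝒢 => ∑ i, ∑ j, (Dl v i j d : ℂ) * (e d *
        (Complex.exp (Complex.I * (t * Dl v i j d : ℝ)) - 1))) = fun d =>
        (∑ i, ∑ j, (Dl v i j d : ℂ) * (e d * Complex.exp (Complex.I * (t * Dl v i j d : ℝ)))) -
        ∑ i, ∑ j, (Dl v i j d : ℂ) * e d := by
      funext d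
      simp_rw [← Finset.sum_sub_distrib]
      refine Finset.sum_congr rfl fun i _ => Finset.sum_congr rfl fun j _ => by ring
    rw [h3, EC_sub]
    linear_combination (2 : ℂ) * h1 - h2
  have key : (EC N 𝒢 Ng (fun d => (Wst v d : ℂ) * e d) - Complex.I * t * s * EC N 𝒢 Ng e) *
      (4 * N) = EC N 𝒢 Ng (fun d => e d * ((∑ i, ∑ j, (Dl v i j d : ℂ) *
        (Complex.exp (Complex.I * (t * Dl v i j d : ℝ)) - 1 - Complex.I * (t * Dl v i j d : ℝ))) +
        Complex.I * t * (4 * N * (Bst v d - s) : ℝ))) := by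
    rw [sub_mul, hsumW]
    rw [show Complex.I * t * s * EC N 𝒢 Ng e * (4 * N) =
      (Complex.I * t * s * (4 * N)) * EC N 𝒢 Ng e by ring, ← EC_const_mul, ← EC_sub]
    congr 1; funext d
    have hB : ((4 * N * (Bst v d - s) : ℝ) : ℂ) = (∑ i, ∑ j, (Dl v i j d : ℂ) ^ 2) - 4 * N * s := by
      have : 4 * N * (Bst v d - s) = (∑ i, ∑ j, Dl v i j d ^ 2) - 4 * N * s := by
        unfold Bst; field_simp
      rw [this]; push_cast; rfl
    rw [hB]
    have : ∀ i j, (Dl v i j d : ℂ) * (e d * (Complex.exp (Complex.I * (t * Dl v i j d : ℝ)) - 1))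
        = e d * ((Dl v i j d : ℂ) * (Complex.exp (Complex.I * (t * Dl v i j d : ℝ)) - 1
          - Complex.I * (t * Dl v i j d : ℝ))) + e d * (Complex.I * t) * (Dl v i j d : ℂ) ^ 2 := by
      intro i j; push_cast; ring
    simp_rw [this, Finset.sum_add_distrib, ← Finset.mul_sum]
    ring
  have hbound : ‖EC N 𝒢 Ng (fun d => e d * ((∑ i, ∑ j, (Dl v i j d : ℂ) *
        (Complex.exp (Complex.I * (t * Dl v i j d : ℝ)) - 1 - Complex.I * (t * Dl v i j d : ℝ))) +
        Complex.I * t * (4 * N * (Bst v d - s) : ℝ)))‖ ≤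
      expec N 𝒢 Ng (fun d => (12 * t ^ 2 * δ * (4 * N)) * Bst v d +
        (|t| * (4 * N)) * |Bst v d - s|) := by
    apply norm_EC_le
    intro d
    have hen : ‖e d‖ = 1 := by
      rw [he]; simp only; rw [mul_comm]; exact Complex.norm_exp_ofReal_mul_I _
    rw [norm_mul, hen, one_mul]
    refine (norm_add_le _ _).trans (add_le_add ?_ ?_)
    · have hD : ∀ i j, |Dl v i j d| ≤ 4 * δ := by
        intro i j
        have h1 := abs_le.1 (hδ i _ (d j).2)
        have h2 := abs_le.1 (hδ j _ (d i).2)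
        have h3 := abs_le.1 (hδ i _ (d i).2)
        have h4 := abs_le.1 (hδ j _ (d j).2)
        unfold Dl
        rw [abs_le]; constructor <;> linarith
      have : 12 * t ^ 2 * δ * (4 * N) * Bst v d =
          ∑ i, ∑ j, (12 * t ^ 2 * δ) * Dl v i j d ^ 2 := by
        simp_rw [← Finset.mul_sum]
        unfold Bst; field_simp
      rw [this]
      refine (norm_sum_le _ _).trans (Finset.sum_le_sum fun i _ => ?_)
      refine (norm_sum_le _ _).trans (Finset.sum_le_sum fun j _ => ?_)
      rw [norm_mul, Complex.norm_real, Real.norm_eq_abs]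
      refine (mul_le_mul (hD i j) (norm_exp_I_sub_le _) (norm_nonneg _)
        ((abs_nonneg _).trans (hD i j))).trans (le_of_eq ?_)
      ring
    · rw [norm_mul, norm_mul, Complex.norm_I, Complex.norm_real, Complex.norm_real,
        Real.norm_eq_abs, Real.norm_eq_abs, abs_mul, abs_of_pos (by positivity : (0 : ℝ) < 4 * N)]
      apply le_of_eq; ring
  rw [← key, norm_mul, expec_add, expec_const_mul, expec_const_mul] at hbound
  have h4N : ‖(4 * N : ℂ)‖ = 4 * N := by simp
  rw [h4N] at hbound
  have : (0 : ℝ) < 4 * N := by positivity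
  refine le_of_mul_le_mul_right (hbound.trans (le_of_eq ?_)) this
  ring

end clt

end Staggered

namespace Staggered

section clt2

variable {N : ℕ} {𝒢 : Finset Date} {Ng : Date → ℕ} (v : Fin N → Date → ℝ)

lemma sum_sq_centre_le (x : Fin N → ℝ) (c : ℝ) (hc : N * c = ∑ i, x i) :
    ∑ i, (x i - c) ^ 2 ≤ ∑ i, x i ^ 2 := by
  have : ∑ i, (x i - c) ^ 2 = ∑ i, x i ^ 2 - N * c ^ 2 := by
    have e : ∀ i, (x i - c) ^ 2 = x i ^ 2 - 2 * c * x i + c ^ 2 := fun i => by ring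
    simp_rw [e, Finset.sum_add_distrib, Finset.sum_sub_distrib, ← Finset.mul_sum, ← hc]
    simp; ring
  rw [this]
  have : (0 : ℝ) ≤ N * c ^ 2 := by positivity
  linarith

/-- Concentration of the normalized squared increments. -/
lemma Bst_bound (hN : 2 ≤ N) (hNg : ∀ g ∈ 𝒢, 1 ≤ Ng g) (hsum : ∑ g ∈ 𝒢, Ng g = N)
    (hrow : ∀ i, ∑ g ∈ 𝒢, Ng g * v i g = 0) (hcol : ∀ g ∈ 𝒢, ∑ i, v i g = 0)
    {δ C : ℝ} (hδ0 : 0 ≤ δ) (hδ : ∀ i, ∀ g ∈ 𝒢, |v i g| ≤ δ)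
    (hC : ∀ g ∈ 𝒢, ∑ i, v i g ^ 2 ≤ C) (s : ℝ) :
    expec N 𝒢 Ng (fun d => |Bst v d - s|) ≤
      |(∑ i, ∑ g ∈ 𝒢, Ng g * v i g ^ 2) / N - s| + 𝒢.card * (δ * Real.sqrt C)
        + (𝒢.card : ℝ) ^ 2 * C / N := by
  have hNpos : (0 : ℝ) < N := by exact_mod_cast (by omega : 0 < N)
  set A := ∑ i, ∑ g ∈ 𝒢, Ng g * v i g ^ 2 with hA
  set m : Date → ℝ := fun g => (∑ i, v i g ^ 2) / N with hm
  have hmN : ∀ g, N * m g = ∑ i, v i g ^ 2 := fun g => by rw [hm]; field_simp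
  set K : ℝ := (𝒢.card : ℝ) with hK
  have hdec : ∀ d ∈ assigns N 𝒢 Ng, |Bst v d - s| ≤ |A / N - s| +
      ((1 / 2) * (∑ g ∈ 𝒢, |Lin g (fun i => v i g ^ 2 - m g) d|) +
      (K / (2 * N)) * (∑ g ∈ 𝒢, Lin g (fun i => v i g) d ^ 2) +
      (1 / (2 * N)) * ∑ g ∈ 𝒢, ∑ h ∈ 𝒢,
        (Lin g (fun i => v i h) d ^ 2 + Lin h (fun i => v i g) d ^ 2) * (1/2)) := by
    intro d hd
    have h1 : ∑ i, v i (d i) ^ 2 = A / N + ∑ g ∈ 𝒢, Lin g (fun i => v i g ^ 2 - m g) d := by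
      rw [← sum_split (fun i g => v i g ^ 2 - m g), Finset.sum_sub_distrib, sum_cohort hd m]
      have : ∑ g ∈ 𝒢, Ng g * m g = A / N := by
        rw [hA, Finset.sum_comm, Finset.sum_div]
        refine Finset.sum_congr rfl fun g _ => ?_
        rw [hm, ← Finset.mul_sum, mul_div_assoc]
      rw [this]; ring
    have h2 : Bst v d - s = (A / N - s) + ((1 / 2) * (∑ g ∈ 𝒢, Lin g (fun i => v i g ^ 2 - m g) d) +
      (1 / (2 * N)) * Wst v d ^ 2 +
      (1 / (2 * N)) * ∑ g ∈ 𝒢, ∑ h ∈ 𝒢, Lin g (fun i => v i h) d * Lin h (fun i => v i g) d) := by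
      unfold Bst
      rw [sum_Dl_sq v hrow hcol hd, ← hA, h1]
      field_simp
      ring
    have hW : Wst v d ^ 2 ≤ K * ∑ g ∈ 𝒢, Lin g (fun i => v i g) d ^ 2 := by
      unfold Wst
      rw [sum_split v]
      exact sq_sum_le_card_mul_sum_sq
    rw [h2]
    refine (abs_add_le _ _).trans (add_le_add le_rfl ?_)
    refine (abs_add_le _ _).trans (add_le_add ((abs_add_le _ _).trans (add_le_add ?_ ?_)) ?_)
    · rw [abs_mul, abs_of_pos (by norm_num : (0 : ℝ) < 1 / 2)]
      exact mul_le_mul_of_nonneg_left (Finset.abs_sum_le_sum_abs _ _) (by norm_num)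
    · rw [abs_of_nonneg (by positivity)]
      calc 1 / (2 * (N : ℝ)) * Wst v d ^ 2 ≤ 1 / (2 * (N : ℝ)) *
          (K * ∑ g ∈ 𝒢, Lin g (fun i => v i g) d ^ 2) :=
            mul_le_mul_of_nonneg_left hW (by positivity)
        _ = _ := by ring
    · rw [abs_mul, abs_of_pos (by positivity : (0 : ℝ) < 1 / (2 * N))]
      refine mul_le_mul_of_nonneg_left ?_ (by positivity)
      refine (Finset.abs_sum_le_sum_abs _ _).trans (Finset.sum_le_sum fun g _ => ?_)
      refine (Finset.abs_sum_le_sum_abs _ _).trans (Finset.sum_le_sum fun h _ => ?_)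
      rw [abs_le]
      constructor <;> nlinarith [sq_nonneg (Lin g (fun i => v i h) d + Lin h (fun i => v i g) d),
        sq_nonneg (Lin g (fun i => v i h) d - Lin h (fun i => v i g) d)]
  refine (expec_mono hdec).trans ?_
  have hC2 : ∀ g ∈ 𝒢, ∀ h ∈ 𝒢, expec N 𝒢 Ng (fun d => Lin g (fun i => v i h) d ^ 2) ≤ C :=
    fun g hg h hh => (expec_Lin_sq_le hN hNg hsum hg _ (hcol h hh)).trans (hC h hh)
  have hL1 : ∀ g ∈ 𝒢, expec N 𝒢 Ng (fun d => |Lin g (fun i => v i g ^ 2 - m g) d|) ≤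
      δ * Real.sqrt C := by
    intro g hg
    refine (expec_abs_le_sqrt hsum _).trans ?_
    rw [← Real.sqrt_sq hδ0, ← Real.sqrt_mul (sq_nonneg _)]
    apply Real.sqrt_le_sqrt
    refine (expec_Lin_sq_le hN hNg hsum hg _ ?_).trans ?_
    · rw [Finset.sum_sub_distrib, ← hmN]; simp
    · refine (sum_sq_centre_le _ _ (hmN g)).trans ?_
      refine le_trans ?_ (mul_le_mul_of_nonneg_left (hC g hg) (sq_nonneg δ))
      rw [Finset.mul_sum]
      refine Finset.sum_le_sum fun i _ => ?_
      rw [sq (v i g ^ 2)]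
      refine mul_le_mul_of_nonneg_right ?_ (sq_nonneg _)
      exact sq_le_sq' (by linarith [(abs_le.1 (hδ i g hg)).1]) (abs_le.1 (hδ i g hg)).2
  rw [expec_add, expec_const hsum, expec_add, expec_add, expec_const_mul, expec_const_mul,
    expec_const_mul, expec_sum, expec_sum, expec_sum]
  have s1 : ∑ g ∈ 𝒢, expec N 𝒢 Ng (fun d => |Lin g (fun i => v i g ^ 2 - m g) d|) ≤
      K * (δ * Real.sqrt C) := by
    refine (Finset.sum_le_sum hL1).trans ?_
    rw [Finset.sum_const, nsmul_eq_mul]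
  have s2 : ∑ g ∈ 𝒢, expec N 𝒢 Ng (fun d => Lin g (fun i => v i g) d ^ 2) ≤ K * C := by
    refine (Finset.sum_le_sum fun g hg => hC2 g hg g hg).trans ?_
    rw [Finset.sum_const, nsmul_eq_mul]
  have s3 : ∑ g ∈ 𝒢, expec N 𝒢 Ng (fun d => ∑ h ∈ 𝒢,
        (Lin g (fun i => v i h) d ^ 2 + Lin h (fun i => v i g) d ^ 2) * (1/2)) ≤ K * (K * C) := by
    have : ∀ g ∈ 𝒢, expec N 𝒢 Ng (fun d => ∑ h ∈ 𝒢,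
        (Lin g (fun i => v i h) d ^ 2 + Lin h (fun i => v i g) d ^ 2) * (1/2)) ≤ K * C := by
      intro g hg
      rw [expec_sum]
      refine (Finset.sum_le_sum (g := fun _ => C) fun h hh => ?_).trans ?_
      · simp_rw [mul_comm _ (1/2 : ℝ)]
        rw [expec_const_mul, expec_add]
        linarith [hC2 g hg h hh, hC2 h hh g hg]
      · rw [Finset.sum_const, nsmul_eq_mul]
    refine (Finset.sum_le_sum this).trans ?_
    rw [Finset.sum_const, nsmul_eq_mul]
  have hK0 : 0 ≤ K := by positivity
  have t1 := mul_le_mul_of_nonneg_left s1 (by norm_num : (0 : ℝ) ≤ 1 / 2)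
  have t2 := mul_le_mul_of_nonneg_left s2 (by positivity : 0 ≤ K / (2 * N))
  have t3 := mul_le_mul_of_nonneg_left s3 (by positivity : 0 ≤ 1 / (2 * (N : ℝ)))
  have u1 : 0 ≤ K * (δ * Real.sqrt C) := by positivity
  have u2 : K / (2 * N) * (K * C) + 1 / (2 * (N : ℝ)) * (K * (K * C)) = K ^ 2 * C / N := by
    field_simp; ring
  linarith

/-- Characteristic function bound. -/
lemma charFun_bound (hN : 0 < N) (hsum : ∑ g ∈ 𝒢, Ng g = N)
    (hrow : ∀ i, ∑ g ∈ 𝒢, Ng g * v i g = 0)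
    {δ η s : ℝ} (hδ0 : 0 ≤ δ) (hδ : ∀ i, ∀ g ∈ 𝒢, |v i g| ≤ δ) (hs : 0 ≤ s)
    (hη : expec N 𝒢 Ng (fun d => |Bst v d - s|) ≤ η) (t : ℝ) :
    ‖EC N 𝒢 Ng (fun d => Complex.exp (Complex.I * (t * Wst v d : ℝ))) -
      Complex.exp (-(s * t ^ 2 / 2 : ℝ))‖ ≤
    (|t| * η + 12 * t ^ 2 * δ * (s + η)) * |t| := by
  have hB : expec N 𝒢 Ng (Bst v) ≤ s + η := by
    have : expec N 𝒢 Ng (Bst v) - s ≤ expec N 𝒢 Ng (fun d => |Bst v d - s|) := by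
      rw [← expec_const (N := N) hsum s, ← expec_sub]
      apply expec_mono
      intro d _
      rw [expec_const hsum]
      exact le_abs_self _
    linarith
  have hη0 : 0 ≤ η := le_trans (expec_nonneg fun d _ => abs_nonneg _) hη
  set φ : ℝ → ℂ := fun u => EC N 𝒢 Ng (fun d => Complex.exp (Complex.I * (u * Wst v d : ℝ))) with hφ
  set φ' : ℝ → ℂ := fun u => Complex.I * EC N 𝒢 Ng (fun d => (Wst v d : ℂ) *
    Complex.exp (Complex.I * (u * Wst v d : ℝ))) with hφ'
  have hder : ∀ u, HasDerivAt φ (φ' u) u := by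
    intro u
    rw [hφ, hφ']
    simp only
    rw [← EC_const_mul]
    unfold EC
    apply HasDerivAt.div_const
    apply HasDerivAt.fun_sum
    intro d _
    have h1 : HasDerivAt (fun u : ℝ => Complex.I * (u * Wst v d : ℝ)) (Complex.I * (Wst v d : ℝ)) u := by
      apply HasDerivAt.const_mul
      have := ((hasDerivAt_id u).mul_const (Wst v d)).ofReal_comp
      simpa using this
    have := h1.cexp
    exact this.congr_deriv (by ring)
  set E : ℝ → ℂ := fun u => Complex.exp ((s * u ^ 2 / 2 : ℝ)) with hE
  have hEder : ∀ u, HasDerivAt E (E u * ((s * u : ℝ) : ℂ)) u := by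
    intro u
    have h1 : HasDerivAt (fun u : ℝ => s * u ^ 2 / 2) (s * u) u := by
      have := (((hasDerivAt_id u).pow 2).const_mul s).div_const 2
      exact this.congr_deriv (by simp; ring)
    exact h1.ofReal_comp.cexp
  have hprod : ∀ u, HasDerivAt (fun u => φ u * E u) (φ' u * E u + φ u * (E u * ((s * u : ℝ) : ℂ))) u :=
    fun u => (hder u).mul (hEder u)
  have hEn : ∀ u, ‖E u‖ = Real.exp (s * u ^ 2 / 2) := by
    intro u; rw [hE]; simp only; rw [← Complex.ofReal_exp, Complex.norm_real, Real.norm_eq_abs,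
      Real.abs_exp]
  have hnorm : ∀ u ∈ Set.uIcc 0 t, ‖φ' u * E u + φ u * (E u * ((s * u : ℝ) : ℂ))‖ ≤
      (|t| * η + 12 * t ^ 2 * δ * (s + η)) * Real.exp (s * t ^ 2 / 2) := by
    intro u hu
    have hut : |u| ≤ |t| := by simpa using Set.abs_sub_left_of_mem_uIcc hu
    have hut2 : u ^ 2 ≤ t ^ 2 := sq_le_sq.2 hut
    have e1 : φ' u * E u + φ u * (E u * ((s * u : ℝ) : ℂ)) =
        Complex.I * (EC N 𝒢 Ng (fun d => (Wst v d : ℂ) *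
          Complex.exp (Complex.I * (u * Wst v d : ℝ))) - Complex.I * u * s * φ u) * E u := by
      rw [hφ']; push_cast
      linear_combination ((u : ℂ) * s * φ u * E u) * Complex.I_sq
    rw [e1, norm_mul, norm_mul, Complex.norm_I, one_mul, hEn]
    refine mul_le_mul ?_ ?_ (Real.exp_pos _).le (by positivity)
    · refine (stein_bound v hN hrow hδ s u).trans (add_le_add ?_ ?_)
      · exact mul_le_mul hut hη (expec_nonneg fun d _ => abs_nonneg _) (abs_nonneg _)
      · have : 12 * u ^ 2 * δ ≤ 12 * t ^ 2 * δ := by gcongr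
        refine mul_le_mul this hB (expec_nonneg fun d _ => ?_) (by positivity)
        unfold Bst; positivity
    · apply Real.exp_le_exp.2; gcongr
  have hmvt := (convex_uIcc (0 : ℝ) t).norm_image_sub_le_of_norm_hasDerivWithin_le
    (fun u _ => (hprod u).hasDerivWithinAt) hnorm Set.left_mem_uIcc Set.right_mem_uIcc
  have hφ0 : φ 0 * E 0 = 1 := by
    have h1 := (assigns_nonempty (𝒢 := 𝒢) hsum).card_pos
    have h2 : ((assigns N 𝒢 Ng).card : ℂ) ≠ 0 := by exact_mod_cast h1.ne'
    simp [hφ, hE, EC, h2]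
  rw [hφ0] at hmvt
  have hinv : Complex.exp (-(s * t ^ 2 / 2 : ℝ)) * E t = 1 := by
    rw [hE]; simp only; rw [← Complex.exp_add]; simp
  have hfin : ‖φ t - Complex.exp (-(s * t ^ 2 / 2 : ℝ))‖ * Real.exp (s * t ^ 2 / 2) ≤
      (|t| * η + 12 * t ^ 2 * δ * (s + η)) * |t| * Real.exp (s * t ^ 2 / 2) := by
    rw [← hEn, ← norm_mul, sub_mul, hinv]
    refine hmvt.trans (le_of_eq ?_)
    rw [hEn]; simp; ring
  exact le_of_mul_le_mul_right hfin (Real.exp_pos _)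

end clt2

/-- Combinatorial CLT (convergence of characteristic functions). -/
lemma clt_charFun (𝒢 : Finset Date) (N : ℕ → ℕ) (Ng : ℕ → Date → ℕ)
    (v : ∀ m, Fin (N m) → Date → ℝ) (hN : ∀ m, 2 ≤ N m) (hNtop : Tendsto N atTop atTop)
    (hNg : ∀ m, ∀ g ∈ 𝒢, 1 ≤ Ng m g) (hsum : ∀ m, ∑ g ∈ 𝒢, Ng m g = N m)
    (hrow : ∀ m i, ∑ g ∈ 𝒢, Ng m g * v m i g = 0) (hcol : ∀ m, ∀ g ∈ 𝒢, ∑ i, v m i g = 0)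
    (hδ : ∀ ε > (0 : ℝ), ∀ᶠ m in atTop, ∀ i, ∀ g ∈ 𝒢, |v m i g| ≤ ε)
    (C : ℝ) (hC : ∀ᶠ m in atTop, ∀ g ∈ 𝒢, ∑ i, v m i g ^ 2 ≤ C) (s : ℝ)
    (hA : Tendsto (fun m => (∑ i, ∑ g ∈ 𝒢, Ng m g * v m i g ^ 2) / (N m : ℝ)) atTop (𝓝 s))
    (t : ℝ) :
    Tendsto (fun m => EC (N m) 𝒢 (Ng m) (fun d => Complex.exp (Complex.I * (t * Wst (v m) d : ℝ))))
      atTop (𝓝 (Complex.exp (-(s * t ^ 2 / 2 : ℝ)))) := by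
  have hs : 0 ≤ s := ge_of_tendsto' hA fun m => by positivity
  rw [tendsto_iff_norm_sub_tendsto_zero]
  have hNr : Tendsto (fun m => (N m : ℝ)) atTop atTop :=
    tendsto_natCast_atTop_atTop.comp hNtop
  set K : ℝ := (𝒢.card : ℝ)
  -- error bound as a function of (x, δ, y)
  let η : ℝ → ℝ → ℝ → ℝ := fun x δ y => x + K * (δ * Real.sqrt C) + y
  let F : ℝ → ℝ → ℝ → ℝ := fun x δ y =>
    (|t| * η x δ y + 12 * t ^ 2 * δ * (s + η x δ y)) * |t|
  have hbd : ∀ δ > 0, ∀ᶠ m in atTop, ‖EC (N m) 𝒢 (Ng m) (fun d =>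
      Complex.exp (Complex.I * (t * Wst (v m) d : ℝ))) - Complex.exp (-(s * t ^ 2 / 2 : ℝ))‖ ≤
      F (|(∑ i, ∑ g ∈ 𝒢, Ng m g * v m i g ^ 2) / (N m : ℝ) - s|) δ (K ^ 2 * C / N m) := by
    intro δ hδ0
    filter_upwards [hδ δ hδ0, hC] with m h1 h2
    exact charFun_bound (v m) (by have := hN m; omega) (hsum m) (hrow m) hδ0.le h1 hs
      (Bst_bound (v m) (hN m) (hNg m) (hsum m) (hrow m) (hcol m) hδ0.le h1 h2 s) t
  have hx : Tendsto (fun m => |(∑ i, ∑ g ∈ 𝒢, Ng m g * v m i g ^ 2) / (N m : ℝ) - s|) atTop (𝓝 0) := by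
    have := (hA.sub_const s).abs
    simpa using this
  have hy : Tendsto (fun m => K ^ 2 * C / (N m : ℝ)) atTop (𝓝 0) := hNr.const_div_atTop _
  have hF : ∀ δ, ∀ xs ys : ℕ → ℝ, Tendsto xs atTop (𝓝 0) → Tendsto ys atTop (𝓝 0) →
      Tendsto (fun m => F (xs m) δ (ys m)) atTop (𝓝 (F 0 δ 0)) := by
    intro δ xs ys hxs hys
    have hη1 : Tendsto (fun m => η (xs m) δ (ys m)) atTop (𝓝 (η 0 δ 0)) :=
      (hxs.add_const _).add hys
    exact ((hη1.const_mul _).add ((hη1.const_add s).const_mul _)).mul_const _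
  have hF0 : Tendsto (fun δ => F 0 δ 0) (𝓝[>] 0) (𝓝 0) := by
    have hc : Continuous fun δ : ℝ => F 0 δ 0 := by
      simp only [F, η]; fun_prop
    have := (hc.tendsto 0).mono_left (nhdsWithin_le_nhds (s := Set.Ioi 0))
    simpa [F, η] using this
  rw [Metric.tendsto_nhds]
  intro ε hε
  have h1 : ∀ᶠ δ in 𝓝[>] (0 : ℝ), F 0 δ 0 < ε := hF0.eventually (gt_mem_nhds hε)
  obtain ⟨δ, hδ1, hδ2⟩ := (h1.and self_mem_nhdsWithin).exists
  filter_upwards [hbd δ hδ2, (hF δ _ _ hx hy).eventually (gt_mem_nhds hδ1)] with m h2 h3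
  rw [dist_zero_right, norm_norm]
  exact h2.trans_lt h3

end Staggered

namespace Staggered

/-! ### Convergence in probability as a filter -/

section pfilter

variable {N : ℕ} {𝒢 : Finset Date} {Ng : Date → ℕ}

lemma prob_eq (P : (Fin N → 𝒢) → Prop) :
    prob N 𝒢 Ng P = expec N 𝒢 Ng (fun d => if P d then 1 else 0) := by
  unfold prob expec
  rw [Finset.sum_boole]

lemma prob_nonneg (P : (Fin N → 𝒢) → Prop) : 0 ≤ prob N 𝒢 Ng P := by
  unfold prob; positivity

lemma prob_mono {P Q : (Fin N → 𝒢) → Prop} (h : ∀ d ∈ assigns N 𝒢 Ng, P d → Q d) :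
    prob N 𝒢 Ng P ≤ prob N 𝒢 Ng Q := by
  rw [prob_eq, prob_eq]
  apply expec_mono
  intro d hd
  by_cases hP : P d
  · simp [hP, h d hd hP]
  · simp only [hP, if_false]; split_ifs <;> norm_num

lemma prob_or (P Q : (Fin N → 𝒢) → Prop) :
    prob N 𝒢 Ng (fun d => P d ∨ Q d) ≤ prob N 𝒢 Ng P + prob N 𝒢 Ng Q := by
  rw [prob_eq, prob_eq, prob_eq, ← expec_add]
  apply expec_mono
  intro d _
  by_cases hP : P d <;> by_cases hQ : Q d <;> simp [hP, hQ]

lemma prob_eq_zero {P : (Fin N → 𝒢) → Prop} (h : ∀ d ∈ assigns N 𝒢 Ng, ¬ P d) :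
    prob N 𝒢 Ng P = 0 := by
  unfold prob
  rw [Finset.filter_false_of_mem h]; simp

lemma prob_markov {f : (Fin N → 𝒢) → ℝ} (hf : ∀ d, 0 ≤ f d) {ε : ℝ} (hε : 0 < ε) :
    prob N 𝒢 Ng (fun d => ε ≤ f d) ≤ expec N 𝒢 Ng f / ε := by
  rw [prob_eq, le_div_iff₀ hε, mul_comm, ← expec_const_mul]
  apply expec_mono
  intro d _
  split_ifs with h
  · simpa using h
  · simpa using hf d

end pfilter

/-- The filter of events whose probability tends to one. -/
def pF (N : ℕ → ℕ) (𝒢 : Finset Date) (Ng : ℕ → Date → ℕ) : Filter (Σ m, (Fin (N m) → 𝒢)) where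
  sets := {S | Tendsto (fun m => prob (N m) 𝒢 (Ng m) (fun d => (⟨m, d⟩ : Σ m, (Fin (N m) → 𝒢)) ∉ S))
    atTop (𝓝 0)}
  univ_sets := by
    simp only [Set.mem_univ, not_true_eq_false, Set.mem_ofPred_eq]
    refine tendsto_const_nhds.congr fun m => ?_
    rw [prob_eq_zero]; simp
  sets_of_superset := by
    intro S S' hS hSS'
    simp only [Set.mem_ofPred_eq] at hS ⊢
    exact squeeze_zero (fun m => prob_nonneg _)
      (fun m => prob_mono fun d _ h h' => h (hSS' h')) hS
  inter_sets := by
    intro S S' hS hS'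
    simp only [Set.mem_ofPred_eq] at hS hS' ⊢
    have := hS.add hS'
    rw [add_zero] at this
    refine squeeze_zero (fun m => prob_nonneg _) (fun m => le_trans (prob_mono ?_) (prob_or _ _)) this
    intro d _ h
    rw [Set.mem_inter_iff, not_and_or] at h
    exact h

section pfilter2

variable {N : ℕ → ℕ} {𝒢 : Finset Date} {Ng : ℕ → Date → ℕ}

lemma mem_pF {S : Set (Σ m, (Fin (N m) → 𝒢))} : S ∈ pF N 𝒢 Ng ↔
    Tendsto (fun m => prob (N m) 𝒢 (Ng m) (fun d => (⟨m, d⟩ : Σ m, (Fin (N m) → 𝒢)) ∉ S))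
    atTop (𝓝 0) := Iff.rfl

lemma eventually_pF {P : (Σ m, (Fin (N m) → 𝒢)) → Prop} : (∀ᶠ x in pF N 𝒢 Ng, P x) ↔
    Tendsto (fun m => prob (N m) 𝒢 (Ng m) (fun d => ¬ P ⟨m, d⟩)) atTop (𝓝 0) := Iff.rfl

lemma tendsto_fst_pF : Tendsto (fun x : Σ m, (Fin (N m) → 𝒢) => x.1) (pF N 𝒢 Ng) atTop := by
  intro S hS
  rw [Filter.mem_map, mem_pF]
  refine tendsto_const_nhds.congr' ?_
  filter_upwards [hS] with m hm
  rw [prob_eq_zero]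
  intro d _
  simpa using hm

lemma eventually_mem_pF : ∀ᶠ x in pF N 𝒢 Ng, x.2 ∈ assigns (N x.1) 𝒢 (Ng x.1) := by
  rw [eventually_pF]
  refine tendsto_const_nhds.congr fun m => ?_
  rw [prob_eq_zero]
  intro d hd
  simpa using hd

lemma tendsto_pF_of_sq (R : ∀ m, (Fin (N m) → 𝒢) → ℝ)
    (h : Tendsto (fun m => expec (N m) 𝒢 (Ng m) (fun d => R m d ^ 2)) atTop (𝓝 0)) :
    Tendsto (fun x => R x.1 x.2) (pF N 𝒢 Ng) (𝓝 0) := by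
  rw [Metric.tendsto_nhds]
  intro ε hε
  rw [eventually_pF]
  have h2 := h.div_const (ε ^ 2)
  rw [zero_div] at h2
  refine squeeze_zero (fun m => prob_nonneg _) (fun m => le_trans (prob_mono ?_)
    (prob_markov (f := fun d => R m d ^ 2) (fun d => sq_nonneg _) (pow_pos hε 2))) h2
  intro d _ hd
  simp only [dist_zero_right, Real.norm_eq_abs, not_lt] at hd
  rw [← sq_abs (R m d)]
  exact pow_le_pow_left₀ hε.le hd 2

lemma tendsto_pF_mul (Z R : ∀ m, (Fin (N m) → 𝒢) → ℝ) (C : ℝ)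
    (hZ : ∀ᶠ m in atTop, expec (N m) 𝒢 (Ng m) (fun d => Z m d ^ 2) ≤ C)
    (hR : Tendsto (fun x => R x.1 x.2) (pF N 𝒢 Ng) (𝓝 0)) :
    Tendsto (fun x => Z x.1 x.2 * R x.1 x.2) (pF N 𝒢 Ng) (𝓝 0) := by
  have hC0 : 0 ≤ C := by
    obtain ⟨m, hm⟩ := hZ.exists
    exact le_trans (expec_nonneg fun d _ => sq_nonneg _) hm
  rw [Metric.tendsto_nhds]
  intro ε hε
  rw [eventually_pF, Metric.tendsto_nhds]
  intro κ hκ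
  -- choose K with C / K² < κ / 2
  obtain ⟨K, hK0, hK⟩ : ∃ K : ℝ, 0 < K ∧ C / K ^ 2 < κ / 2 := by
    have : Tendsto (fun K : ℝ => C / K ^ 2) atTop (𝓝 0) :=
      (tendsto_pow_atTop (by norm_num)).const_div_atTop C
    obtain ⟨K, h1, h2⟩ := ((eventually_gt_atTop (0 : ℝ)).and
      (this.eventually (gt_mem_nhds (half_pos hκ)))).exists
    exact ⟨K, h1, h2⟩
  have hR' := (Metric.tendsto_nhds.1 hR) (ε / K) (by positivity)
  rw [eventually_pF] at hR'
  filter_upwards [hZ, hR'.eventually (gt_mem_nhds (half_pos hκ))] with m h1 h2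
  rw [dist_zero_right, Real.norm_eq_abs, abs_of_nonneg (prob_nonneg _)]
  have h3 : prob (N m) 𝒢 (Ng m) (fun d => K ^ 2 ≤ Z m d ^ 2) ≤ C / K ^ 2 :=
    (prob_markov (fun d => sq_nonneg _) (by positivity)).trans (by gcongr)
  refine lt_of_le_of_lt (le_trans (prob_mono ?_) (prob_or
    (fun d => K ^ 2 ≤ Z m d ^ 2) (fun d => ¬ dist (R m d) 0 < ε / K)))
    (by linarith [add_lt_add_of_le_of_lt h3 h2])
  intro d _ hd
  simp only [dist_zero_right, Real.norm_eq_abs, not_lt] at hd ⊢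
  by_contra hcon
  push Not at hcon
  have hz : |Z m d| < K := abs_lt_of_sq_lt_sq hcon.1 hK0.le
  have hr := hcon.2
  rw [abs_mul] at hd
  have : |Z m d| * |R m d| ≤ K * |R m d| := by gcongr
  rw [lt_div_iff₀ hK0] at hr
  linarith

lemma tendsto_expec_of_pF (hsum : ∀ m, ∑ g ∈ 𝒢, Ng m g = N m)
    (h : ∀ m, (Fin (N m) → 𝒢) → ℝ) (C : ℝ) (hC : ∀ m d, h m d ≤ C)
    (h0 : ∀ m d, 0 ≤ h m d)
    (ht : Tendsto (fun x => h x.1 x.2) (pF N 𝒢 Ng) (𝓝 0)) :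
    Tendsto (fun m => expec (N m) 𝒢 (Ng m) (h m)) atTop (𝓝 0) := by
  rw [Metric.tendsto_nhds]
  intro ε hε
  have hR' := (Metric.tendsto_nhds.1 ht) (ε / 2) (by positivity)
  rw [eventually_pF] at hR'
  have h4 := hR'.const_mul C
  rw [mul_zero] at h4
  filter_upwards [h4.eventually (gt_mem_nhds (half_pos hε))] with m hm
  rw [dist_zero_right, Real.norm_eq_abs, abs_of_nonneg (expec_nonneg fun d _ => h0 m d)]
  have : expec (N m) 𝒢 (Ng m) (h m) ≤ ε / 2 + C * prob (N m) 𝒢 (Ng m) (fun d =>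
      ¬ dist (h m d) 0 < ε / 2) := by
    rw [prob_eq, ← expec_const_mul, ← expec_const (hsum m) (ε / 2), ← expec_add,
      expec_const (hsum m)]
    apply expec_mono
    intro d _
    by_cases hd : dist (h m d) 0 < ε / 2
    · rw [if_neg (not_not.2 hd)]
      rw [dist_zero_right, Real.norm_eq_abs, abs_of_nonneg (h0 m d)] at hd
      linarith
    · rw [if_pos hd]
      linarith [hC m d]
  linarith

/-- Slutsky's lemma at the level of characteristic functions. -/
lemma slutsky (hsum : ∀ m, ∑ g ∈ 𝒢, Ng m g = N m)
    (W R : ∀ m, (Fin (N m) → 𝒢) → ℝ) (t : ℝ) (z : ℂ)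
    (hR : Tendsto (fun x => R x.1 x.2) (pF N 𝒢 Ng) (𝓝 0))
    (hW : Tendsto (fun m => EC (N m) 𝒢 (Ng m) (fun d => Complex.exp (Complex.I * (t * W m d : ℝ))))
      atTop (𝓝 z)) :
    Tendsto (fun m => EC (N m) 𝒢 (Ng m) (fun d =>
      Complex.exp (Complex.I * (t * (W m d + R m d) : ℝ)))) atTop (𝓝 z) := by
  have hdiff : Tendsto (fun m => EC (N m) 𝒢 (Ng m) (fun d =>
      Complex.exp (Complex.I * (t * (W m d + R m d) : ℝ))) - EC (N m) 𝒢 (Ng m) (fun d =>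
      Complex.exp (Complex.I * (t * W m d : ℝ)))) atTop (𝓝 0) := by
    have hlim : Tendsto (fun m => expec (N m) 𝒢 (Ng m) (fun d =>
        ‖Complex.exp (Complex.I * (t * R m d : ℝ)) - 1‖)) atTop (𝓝 0) := by
      apply tendsto_expec_of_pF hsum _ 2
      · intro m d
        refine (norm_sub_le _ _).trans ?_
        rw [mul_comm, Complex.norm_exp_ofReal_mul_I]; norm_num
      · intro m d; exact norm_nonneg _
      · have hc : Continuous fun r : ℝ => ‖Complex.exp (Complex.I * (t * r : ℝ)) - 1‖ := by
          fun_prop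
        have := (hc.tendsto 0).comp hR
        simp only [mul_zero, Complex.ofReal_zero, Complex.exp_zero, sub_self, norm_zero] at this
        exact this
    refine squeeze_zero_norm (fun m => ?_) hlim
    rw [← EC_sub]
    apply norm_EC_le
    intro d
    rw [show Complex.exp (Complex.I * (t * (W m d + R m d) : ℝ)) -
      Complex.exp (Complex.I * (t * W m d : ℝ)) = Complex.exp (Complex.I * (t * W m d : ℝ)) *
      (Complex.exp (Complex.I * (t * R m d : ℝ)) - 1) by
        rw [mul_sub, ← Complex.exp_add, mul_one]; push_cast; ring_nf]
    rw [norm_mul, mul_comm Complex.I, Complex.norm_exp_ofReal_mul_I, one_mul]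
  have := hW.add hdiff
  simpa using this

/-- The law of a statistic. -/
def lawM (N : ℕ) (𝒢 : Finset Date) (Ng : Date → ℕ) (W : (Fin N → 𝒢) → ℝ) : Measure ℝ :=
  ((assigns N 𝒢 Ng).card : ℝ≥0∞)⁻¹ • ∑ d ∈ assigns N 𝒢 Ng, Measure.dirac (W d)

lemma lawM_prob (N : ℕ) (𝒢 : Finset Date) (Ng : Date → ℕ) (hsum : ∑ g ∈ 𝒢, Ng g = N)
    (W : (Fin N → 𝒢) → ℝ) : IsProbabilityMeasure (lawM N 𝒢 Ng W) := by
  constructor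
  have h1 := (assigns_nonempty (𝒢 := 𝒢) hsum).card_pos
  unfold lawM
  rw [Measure.smul_apply, Measure.finsetSum_apply]
  simp
  exact ENNReal.inv_mul_cancel (by exact_mod_cast h1.ne') (by simp)

lemma integral_lawM {E : Type*} [NormedAddCommGroup E] [NormedSpace ℝ E] [CompleteSpace E]
    (N : ℕ) (𝒢 : Finset Date) (Ng : Date → ℕ)
    (W : (Fin N → 𝒢) → ℝ) (f : ℝ → E) :
    ∫ x, f x ∂(lawM N 𝒢 Ng W) = ((assigns N 𝒢 Ng).card : ℝ)⁻¹ • ∑ d ∈ assigns N 𝒢 Ng, f (W d) := by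
  unfold lawM
  rw [integral_smul_measure, integral_finsetSum_measure]
  · simp
  · intro d _
    exact integrable_dirac (by simp)

lemma levy (hsum : ∀ m, ∑ g ∈ 𝒢, Ng m g = N m)
    (W : ∀ m, (Fin (N m) → 𝒢) → ℝ) (s : ℝ) (hs : 0 ≤ s)
    (hW : ∀ t : ℝ, Tendsto (fun m => EC (N m) 𝒢 (Ng m) (fun d =>
      Complex.exp (Complex.I * (t * W m d : ℝ)))) atTop (𝓝 (Complex.exp (-(s * t ^ 2 / 2 : ℝ)))))
    (f : ℝ → ℝ) (hf : Continuous f) (hb : IsBounded f) :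
    Tendsto (fun m => expec (N m) 𝒢 (Ng m) (fun d => f (W m d))) atTop
      (𝓝 (∫ x, f x ∂(gaussianReal 0 (Real.toNNReal s)))) := by
  let μ : ℕ → ProbabilityMeasure ℝ := fun m => ⟨lawM (N m) 𝒢 (Ng m) (W m), lawM_prob _ _ _ (hsum m) _⟩
  let μ₀ : ProbabilityMeasure ℝ := ⟨gaussianReal 0 (Real.toNNReal s), inferInstance⟩
  have hμ : Tendsto μ atTop (𝓝 μ₀) := by
    apply ProbabilityMeasure.tendsto_of_tendsto_charFun
    intro t
    have h1 : charFun (μ₀ : Measure ℝ) t = Complex.exp (-(s * t ^ 2 / 2 : ℝ)) := by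
      change charFun (gaussianReal 0 (Real.toNNReal s)) t = _
      rw [charFun_gaussianReal, Real.coe_toNNReal _ hs]
      congr 1; push_cast; ring
    rw [h1]
    refine (hW t).congr fun m => ?_
    change _ = charFun (lawM (N m) 𝒢 (Ng m) (W m)) t
    rw [charFun_apply_real, integral_lawM]
    unfold EC
    rw [Complex.real_smul, div_eq_inv_mul]
    push_cast
    congr 1
    refine Finset.sum_congr rfl fun d _ => ?_
    congr 1; ring
  rw [ProbabilityMeasure.tendsto_iff_forall_integral_tendsto] at hμ
  obtain ⟨C, hC⟩ := hb
  let fb : BoundedContinuousFunction ℝ ℝ :=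
    BoundedContinuousFunction.ofNormedAddCommGroup f hf C hC
  have := hμ fb
  refine this.congr fun m => ?_
  change ∫ x, f x ∂(lawM (N m) 𝒢 (Ng m) (W m)) = _
  rw [integral_lawM]
  unfold expec
  rw [smul_eq_mul, div_eq_inv_mul]

end pfilter2

end Staggered

namespace Staggered

/-! ### Linear statistics in the cohort means -/

section linstat

variable {N T : ℕ} {𝒢 : Finset Date} {Ng : Date → ℕ}

/-- Centred scores `c_g' (Y_i(g) - mean)`. -/
def uSc (Y : Fin N → Date → Fin T → ℝ) (c : Date → Fin T → ℝ) (i : Fin N) (g : Date) : ℝ :=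
  ∑ t, c g t * (Y i g t - popMeanV N T (fun i => Y i g) t)

/-- The population value of a linear combination of cohort means. -/
def Pc (𝒢 : Finset Date) (Y : Fin N → Date → Fin T → ℝ) (c : Date → Fin T → ℝ) : ℝ :=
  ∑ g ∈ 𝒢, ∑ t, c g t * popMeanV N T (fun i => Y i g) t

/-- Linear combination of cohort means. -/
def Lc (Ng : Date → ℕ) (c : Date → Fin T → ℝ) (y : Fin N → Fin T → ℝ) (d : Fin N → 𝒢) : ℝ :=
  ∑ g ∈ 𝒢, ∑ t, c g t * cmean Ng y d g t

/-- Its centred version. -/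
def Zc (Ng : Date → ℕ) (Y : Fin N → Date → Fin T → ℝ) (c : Date → Fin T → ℝ)
    (d : Fin N → 𝒢) : ℝ :=
  ∑ g ∈ 𝒢, (Ng g : ℝ)⁻¹ * Lin g (fun i => uSc Y c i g) d

/-- Total-score covariance. -/
def totC (𝒢 : Finset Date) (Y : Fin N → Date → Fin T → ℝ) (c c' : Date → Fin T → ℝ) : ℝ :=
  (∑ i, (∑ g ∈ 𝒢, uSc Y c i g) * (∑ g ∈ 𝒢, uSc Y c' i g)) / ((N : ℝ) - 1)

/-- Bilinear form. -/
def bil (S : Matrix (Fin T) (Fin T) ℝ) (x y : Fin T → ℝ) : ℝ := ∑ t, ∑ t', x t * S t t' * y t'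

lemma bil_eq (S : Matrix (Fin T) (Fin T) ℝ) (x y : Fin T → ℝ) : bil S x y = x ⬝ᵥ S.mulVec y := by
  simp only [bil, dotProduct, Matrix.mulVec, Finset.mul_sum]
  exact Finset.sum_congr rfl fun t _ => Finset.sum_congr rfl fun t' _ => by ring

lemma contrast_sum (𝒢 : Finset Date) (a : Fin T → Date → Date → ℝ) (z : Date → Fin T → ℝ) :
    ∑ t, ∑ g ∈ 𝒢, ∑ g' ∈ 𝒢, a t g g' * (z g t - z g' t) =
      ∑ g ∈ 𝒢, ∑ t, Atheta T 𝒢 a g t * z g t := by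
  rw [Finset.sum_comm (s := 𝒢)]
  refine Finset.sum_congr rfl fun t _ => ?_
  simp only [Atheta, mul_sub, Finset.sum_sub_distrib, sub_mul, Finset.sum_mul]
  congr 1
  rw [Finset.sum_comm]

lemma thetaHat0_eq (a : Fin T → Date → Date → ℝ) (y : Fin N → Fin T → ℝ) (d : Fin N → 𝒢) :
    thetaHat0 𝒢 Ng a y d = Lc Ng (Atheta T 𝒢 a) y d := by
  unfold thetaHat0 Lc
  exact contrast_sum 𝒢 a (fun g t => cmean Ng y d g t)

lemma Xhat_eq {M : ℕ} (b : Fin M → Fin T → Date → Date → ℝ) (y : Fin N → Fin T → ℝ)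
    (d : Fin N → 𝒢) (j : Fin M) :
    Xhat 𝒢 Ng b y d j = Lc Ng (Atheta T 𝒢 (b j)) y d := thetaHat0_eq (b j) y d

lemma thetaParam_eq (a : Fin T → Date → Date → ℝ) (Y : Fin N → Date → Fin T → ℝ) :
    thetaParam N T 𝒢 Y a = Pc 𝒢 Y (Atheta T 𝒢 a) := by
  unfold thetaParam Pc
  rw [← contrast_sum 𝒢 a]
  refine Finset.sum_congr rfl fun t _ => Finset.sum_congr rfl fun g _ =>
    Finset.sum_congr rfl fun g' _ => ?_
  unfold tau popMeanV
  rw [Finset.sum_sub_distrib, sub_div]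

lemma cmean_obs (Y : Fin N → Date → Fin T → ℝ) (d : Fin N → 𝒢) (g : Date) (t : Fin T) :
    cmean Ng (obs Y d) d g t = Lin g (fun i => Y i g t) d / Ng g := by
  unfold cmean Lin obs
  congr 1
  refine Finset.sum_congr rfl fun i _ => ?_
  split_ifs with h
  · rw [h]
  · rfl

lemma Lin_sub (g : Date) (x y : Fin N → ℝ) (d : Fin N → 𝒢) :
    Lin g (fun i => x i - y i) d = Lin g x d - Lin g y d := by
  simp only [Lin_eq, sub_mul, Finset.sum_sub_distrib]

lemma Lin_const {d : Fin N → 𝒢} (hd : d ∈ assigns N 𝒢 Ng) {g : Date} (hg : g ∈ 𝒢) (c : ℝ) :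
    Lin g (fun _ => c) d = Ng g * c := by
  simp only [Lin_eq, ← Finset.mul_sum]
  rw [sum_ind hd hg, mul_comm]

lemma Lin_sum_mul {ι : Type*} (s : Finset ι) (g : Date) (c : ι → ℝ) (x : Fin N → ι → ℝ)
    (d : Fin N → 𝒢) :
    Lin g (fun i => ∑ k ∈ s, c k * x i k) d = ∑ k ∈ s, c k * Lin g (fun i => x i k) d := by
  simp only [Lin_eq, Finset.mul_sum, Finset.sum_mul]
  rw [Finset.sum_comm]
  exact Finset.sum_congr rfl fun k _ => Finset.sum_congr rfl fun i _ => by ring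

lemma Lc_eq (hNg : ∀ g ∈ 𝒢, 1 ≤ Ng g) (Y : Fin N → Date → Fin T → ℝ) (c : Date → Fin T → ℝ)
    {d : Fin N → 𝒢} (hd : d ∈ assigns N 𝒢 Ng) :
    Lc Ng c (obs Y d) d = Pc 𝒢 Y c + Zc Ng Y c d := by
  unfold Lc Pc Zc
  rw [← Finset.sum_add_distrib]
  refine Finset.sum_congr rfl fun g hg => ?_
  have hpos : (0 : ℝ) < Ng g := by exact_mod_cast hNg g hg
  unfold uSc
  rw [Lin_sum_mul, Finset.mul_sum, ← Finset.sum_add_distrib]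
  refine Finset.sum_congr rfl fun t _ => ?_
  rw [cmean_obs, Lin_sub, Lin_const hd hg]
  field_simp
  ring

lemma sum_centred (hN : 0 < N) (x : Fin N → Fin T → ℝ) (t : Fin T) :
    ∑ i, (x i t - popMeanV N T x t) = 0 := by
  have : (0 : ℝ) < N := by exact_mod_cast hN
  unfold popMeanV
  rw [Finset.sum_sub_distrib]
  simp
  field_simp
  ring

lemma sum_uSc (hN : 0 < N) (Y : Fin N → Date → Fin T → ℝ) (c : Date → Fin T → ℝ) (g : Date) :
    ∑ i, uSc Y c i g = 0 := by
  unfold uSc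
  rw [Finset.sum_comm]
  refine Finset.sum_eq_zero fun t _ => ?_
  rw [← Finset.mul_sum, sum_centred hN (fun i => Y i g), mul_zero]

lemma sum_uSc_mul (Y : Fin N → Date → Fin T → ℝ) (c c' : Date → Fin T → ℝ) (g : Date) :
    (∑ i, uSc Y c i g * uSc Y c' i g) / ((N : ℝ) - 1) = bil (Sg N T Y g) (c g) (c' g) := by
  unfold uSc bil Sg popCov
  simp only [Matrix.of_apply, Finset.sum_mul_sum]
  rw [Finset.sum_comm, Finset.sum_div]
  refine Finset.sum_congr rfl fun t _ => ?_
  rw [Finset.sum_comm, Finset.sum_div]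
  refine Finset.sum_congr rfl fun t' _ => ?_
  rw [mul_div_assoc', div_mul_eq_mul_div, Finset.mul_sum, Finset.sum_mul]
  congr 1
  exact Finset.sum_congr rfl fun i _ => by ring

/-- Exact covariance of linear statistics (Neyman). -/
lemma expec_Zc_mul (hN : 2 ≤ N) (hNg : ∀ g ∈ 𝒢, 1 ≤ Ng g) (hsum : ∑ g ∈ 𝒢, Ng g = N)
    (Y : Fin N → Date → Fin T → ℝ) (c c' : Date → Fin T → ℝ) :
    N * expec N 𝒢 Ng (fun d => Zc Ng Y c d * Zc Ng Y c' d) =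
      ∑ g ∈ 𝒢, ((N : ℝ) / Ng g) * bil (Sg N T Y g) (c g) (c' g) - totC 𝒢 Y c c' := by
  have hNpos : (0 : ℝ) < N := by exact_mod_cast (by omega : 0 < N)
  have h1 : ∀ d : Fin N → 𝒢, Zc Ng Y c d * Zc Ng Y c' d = ∑ g ∈ 𝒢, ∑ h ∈ 𝒢,
      ((Ng g : ℝ)⁻¹ * (Ng h : ℝ)⁻¹) *
      (Lin g (fun i => uSc Y c i g) d * Lin h (fun i => uSc Y c' i h) d) := by
    intro d
    unfold Zc
    rw [Finset.sum_mul_sum]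
    exact Finset.sum_congr rfl fun g _ => Finset.sum_congr rfl fun h _ => by ring
  have h2 : totC 𝒢 Y c c' = ∑ g ∈ 𝒢, ∑ h ∈ 𝒢,
      (∑ i, uSc Y c i g * uSc Y c' i h) / ((N : ℝ) - 1) := by
    unfold totC
    simp_rw [Finset.sum_mul_sum, ← Finset.sum_div]
    congr 1
    rw [Finset.sum_comm]
    exact Finset.sum_congr rfl fun g _ => Finset.sum_comm
  simp_rw [h1, expec_sum, expec_const_mul]
  rw [h2, ← Finset.sum_sub_distrib, Finset.mul_sum]
  refine Finset.sum_congr rfl fun g hg => ?_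
  have hg0 : (0 : ℝ) < Ng g := by exact_mod_cast hNg g hg
  have h3 : ((N : ℝ) / Ng g) * bil (Sg N T Y g) (c g) (c' g) = ∑ h ∈ 𝒢, (if g = h then
      ((N : ℝ) / Ng g) * ((∑ i, uSc Y c i g * uSc Y c' i h) / ((N : ℝ) - 1)) else 0) := by
    rw [Finset.sum_ite_eq, if_pos hg, sum_uSc_mul]
  rw [h3, ← Finset.sum_sub_distrib, Finset.mul_sum]
  refine Finset.sum_congr rfl fun h hh => ?_
  have hh0 : (0 : ℝ) < Ng h := by exact_mod_cast hNg h hh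
  rw [expec_Lin_mul hN hsum hg hh _ _ (sum_uSc (by omega) Y c g) (sum_uSc (by omega) Y c' h)]
  generalize (∑ i, uSc Y c i g * uSc Y c' i h) / ((N : ℝ) - 1) = q
  split_ifs with hgh
  · subst hgh
    field_simp
  · field_simp
    ring

lemma expec_Zc (hN : 0 < N) (hsum : ∑ g ∈ 𝒢, Ng g = N)
    (Y : Fin N → Date → Fin T → ℝ) (c : Date → Fin T → ℝ) :
    expec N 𝒢 Ng (Zc Ng Y c) = 0 := by
  have : (Zc Ng Y c : (Fin N → 𝒢) → ℝ) = fun d =>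
    ∑ g ∈ 𝒢, (Ng g : ℝ)⁻¹ * Lin g (fun i => uSc Y c i g) d := rfl
  rw [this, expec_sum]
  refine Finset.sum_eq_zero fun g hg => ?_
  rw [expec_const_mul, expec_Lin hN hsum hg, sum_uSc hN]; simp

lemma expec_Lc (hN : 0 < N) (hNg : ∀ g ∈ 𝒢, 1 ≤ Ng g) (hsum : ∑ g ∈ 𝒢, Ng g = N)
    (Y : Fin N → Date → Fin T → ℝ) (c : Date → Fin T → ℝ) :
    expec N 𝒢 Ng (fun d => Lc Ng c (obs Y d) d) = Pc 𝒢 Y c := by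
  rw [expec_congr fun d hd => Lc_eq hNg Y c hd, expec_add, expec_const hsum,
    expec_Zc hN hsum, add_zero]

lemma covE_Lc (hN : 2 ≤ N) (hNg : ∀ g ∈ 𝒢, 1 ≤ Ng g) (hsum : ∑ g ∈ 𝒢, Ng g = N)
    (Y : Fin N → Date → Fin T → ℝ) (c c' : Date → Fin T → ℝ) :
    N * covE N 𝒢 Ng (fun d => Lc Ng c (obs Y d) d) (fun d => Lc Ng c' (obs Y d) d) =
      ∑ g ∈ 𝒢, ((N : ℝ) / Ng g) * bil (Sg N T Y g) (c g) (c' g) - totC 𝒢 Y c c' := by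
  rw [← expec_Zc_mul hN hNg hsum]
  unfold covE
  rw [expec_Lc (by omega) hNg hsum, expec_Lc (by omega) hNg hsum]
  congr 1
  apply expec_congr
  intro d hd
  beta_reduce
  rw [Lc_eq hNg Y c hd, Lc_eq hNg Y c' hd]; ring

lemma sum_uSc_eq (Y : Fin N → Date → Fin T → ℝ) (c : Date → Fin T → ℝ) (i : Fin N) :
    ∑ g ∈ 𝒢, uSc Y c i g = ∑ g ∈ 𝒢, c g ⬝ᵥ Y i g - Pc 𝒢 Y c := by
  unfold uSc Pc
  rw [← Finset.sum_sub_distrib]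
  refine Finset.sum_congr rfl fun g _ => ?_
  simp only [dotProduct, mul_sub, Finset.sum_sub_distrib]

lemma popMeanS_tot (Y : Fin N → Date → Fin T → ℝ) (c : Date → Fin T → ℝ) :
    popMeanS N (fun i => ∑ g ∈ 𝒢, c g ⬝ᵥ Y i g) = Pc 𝒢 Y c := by
  unfold popMeanS Pc popMeanV
  rw [Finset.sum_comm, Finset.sum_div]
  refine Finset.sum_congr rfl fun g _ => ?_
  simp only [dotProduct]
  rw [Finset.sum_comm, Finset.sum_div]
  refine Finset.sum_congr rfl fun t _ => ?_
  rw [← Finset.mul_sum, mul_div_assoc]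

lemma totC_theta (Y : Fin N → Date → Fin T → ℝ) (a : Fin T → Date → Date → ℝ) :
    totC 𝒢 Y (Atheta T 𝒢 a) (Atheta T 𝒢 a) = Stheta N T 𝒢 Y a := by
  unfold totC Stheta popVarS
  rw [popMeanS_tot]
  congr 1
  refine Finset.sum_congr rfl fun i _ => ?_
  rw [sum_uSc_eq, sq]

/-- No anticipation annihilates the unit-level contrasts. -/
lemma noant (Y : Fin N → Date → Fin T → ℝ) (b : Fin T → Date → Date → ℝ)
    (hNA : ∀ (i : Fin N) (t : Fin T), ∀ g ∈ 𝒢, ∀ g' ∈ 𝒢,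
      periodLT t g → periodLT t g' → Y i g t = Y i g' t)
    (hb : ∀ (t : Fin T) (g g' : Date), b t g g' ≠ 0 → periodLT t g ∧ periodLT t g') (i : Fin N) :
    ∑ g ∈ 𝒢, Atheta T 𝒢 b g ⬝ᵥ Y i g = 0 := by
  have := contrast_sum 𝒢 b (fun g t => Y i g t)
  simp only [dotProduct]
  rw [← this]
  refine Finset.sum_eq_zero fun t _ => Finset.sum_eq_zero fun g hg =>
    Finset.sum_eq_zero fun g' hg' => ?_
  by_cases h : b t g g' = 0
  · rw [h, zero_mul]
  · obtain ⟨h1, h2⟩ := hb t g g' h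
    rw [hNA i t g hg g' hg' h1 h2, sub_self, mul_zero]

lemma noant_Pc (Y : Fin N → Date → Fin T → ℝ) (b : Fin T → Date → Date → ℝ)
    (h : ∀ i, ∑ g ∈ 𝒢, Atheta T 𝒢 b g ⬝ᵥ Y i g = 0) : Pc 𝒢 Y (Atheta T 𝒢 b) = 0 := by
  rw [← popMeanS_tot]
  simp_rw [h]
  simp [popMeanS]

lemma noant_uSc (Y : Fin N → Date → Fin T → ℝ) (b : Fin T → Date → Date → ℝ)
    (h : ∀ i, ∑ g ∈ 𝒢, Atheta T 𝒢 b g ⬝ᵥ Y i g = 0) (i : Fin N) :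
    ∑ g ∈ 𝒢, uSc Y (Atheta T 𝒢 b) i g = 0 := by
  rw [sum_uSc_eq, h, noant_Pc Y b h, sub_zero]

/-- Adjusted weights `A_θ - Σ_j β_j A_{0,j}`. -/
def cB {M : ℕ} (𝒢 : Finset Date) (a : Fin T → Date → Date → ℝ)
    (b : Fin M → Fin T → Date → Date → ℝ) (β : Fin M → ℝ) : Date → Fin T → ℝ :=
  fun g t => Atheta T 𝒢 a g t - ∑ j, β j * Atheta T 𝒢 (b j) g t

lemma cB_sum {M : ℕ} (𝒢 : Finset Date) (a : Fin T → Date → Date → ℝ)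
    (b : Fin M → Fin T → Date → Date → ℝ) (β : Fin M → ℝ) (z : Date → Fin T → ℝ) :
    ∑ g ∈ 𝒢, ∑ t, cB 𝒢 a b β g t * z g t = ∑ g ∈ 𝒢, ∑ t, Atheta T 𝒢 a g t * z g t -
      ∑ j, (∑ g ∈ 𝒢, ∑ t, Atheta T 𝒢 (b j) g t * z g t) * β j := by
  have h : ∑ j, (∑ g ∈ 𝒢, ∑ t, Atheta T 𝒢 (b j) g t * z g t) * β j =
      ∑ g ∈ 𝒢, ∑ t, (∑ j, β j * Atheta T 𝒢 (b j) g t) * z g t := by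
    simp only [Finset.sum_mul]
    rw [Finset.sum_comm]
    refine Finset.sum_congr rfl fun g _ => ?_
    rw [Finset.sum_comm]
    exact Finset.sum_congr rfl fun t _ => Finset.sum_congr rfl fun j _ => by ring
  rw [h, ← Finset.sum_sub_distrib]
  refine Finset.sum_congr rfl fun g _ => ?_
  rw [← Finset.sum_sub_distrib]
  exact Finset.sum_congr rfl fun t _ => by simp only [cB]; ring

lemma Lc_cB {M : ℕ} (a : Fin T → Date → Date → ℝ)
    (b : Fin M → Fin T → Date → Date → ℝ) (β : Fin M → ℝ) (y : Fin N → Fin T → ℝ)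
    (d : Fin N → 𝒢) :
    Lc Ng (cB 𝒢 a b β) y d = thetaHat0 𝒢 Ng a y d - ∑ j, Xhat 𝒢 Ng b y d j * β j := by
  simp_rw [thetaHat0_eq, Xhat_eq]
  exact cB_sum 𝒢 a b β fun g t => cmean Ng y d g t

lemma Pc_cB {M : ℕ} (a : Fin T → Date → Date → ℝ)
    (b : Fin M → Fin T → Date → Date → ℝ) (β : Fin M → ℝ) (Y : Fin N → Date → Fin T → ℝ)
    (h : ∀ j i, ∑ g ∈ 𝒢, Atheta T 𝒢 (b j) g ⬝ᵥ Y i g = 0) :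
    Pc 𝒢 Y (cB 𝒢 a b β) = thetaParam N T 𝒢 Y a := by
  rw [thetaParam_eq]
  have h1 : Pc 𝒢 Y (cB 𝒢 a b β) = Pc 𝒢 Y (Atheta T 𝒢 a) -
      ∑ j, Pc 𝒢 Y (Atheta T 𝒢 (b j)) * β j :=
    cB_sum 𝒢 a b β fun g t => popMeanV N T (fun i => Y i g) t
  rw [h1]
  simp [fun j => noant_Pc Y (b j) (h j)]

lemma uSc_cB {M : ℕ} (a : Fin T → Date → Date → ℝ)
    (b : Fin M → Fin T → Date → Date → ℝ) (β : Fin M → ℝ) (Y : Fin N → Date → Fin T → ℝ)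
    (h : ∀ j i, ∑ g ∈ 𝒢, Atheta T 𝒢 (b j) g ⬝ᵥ Y i g = 0) (i : Fin N) :
    ∑ g ∈ 𝒢, uSc Y (cB 𝒢 a b β) i g = ∑ g ∈ 𝒢, uSc Y (Atheta T 𝒢 a) i g := by
  have h1 : ∑ g ∈ 𝒢, uSc Y (cB 𝒢 a b β) i g = ∑ g ∈ 𝒢, uSc Y (Atheta T 𝒢 a) i g -
      ∑ j, (∑ g ∈ 𝒢, uSc Y (Atheta T 𝒢 (b j)) i g) * β j :=
    cB_sum 𝒢 a b β fun g t => Y i g t - popMeanV N T (fun i => Y i g) t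
  rw [h1]
  simp [fun j => noant_uSc Y (b j) (h j) i]

lemma totC_cB {M : ℕ} (a : Fin T → Date → Date → ℝ)
    (b : Fin M → Fin T → Date → Date → ℝ) (β : Fin M → ℝ) (Y : Fin N → Date → Fin T → ℝ)
    (h : ∀ j i, ∑ g ∈ 𝒢, Atheta T 𝒢 (b j) g ⬝ᵥ Y i g = 0) :
    totC 𝒢 Y (cB 𝒢 a b β) (cB 𝒢 a b β) = Stheta N T 𝒢 Y a := by
  rw [← totC_theta]
  unfold totC
  simp_rw [uSc_cB a b β Y h]

lemma totC_zero (Y : Fin N → Date → Fin T → ℝ) (b : Fin T → Date → Date → ℝ)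
    (c : Date → Fin T → ℝ)
    (h : ∀ i, ∑ g ∈ 𝒢, Atheta T 𝒢 b g ⬝ᵥ Y i g = 0) : totC 𝒢 Y (Atheta T 𝒢 b) c = 0 := by
  unfold totC
  simp [noant_uSc Y b h]

end linstat

end Staggered

namespace Staggered

/-! ### Limits: linear algebra -/

section limalg

variable {T M : ℕ} {𝒢 : Finset Date}

/-- Weighted quadratic form over cohorts. -/
def Qf (𝒢 : Finset Date) (w : Date → ℝ) (S : Date → Matrix (Fin T) (Fin T) ℝ)
    (c c' : Date → Fin T → ℝ) : ℝ := ∑ g ∈ 𝒢, w g * bil (S g) (c g) (c' g)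

lemma tendsto_Qf {α : Type*} {l : Filter α} {w : α → Date → ℝ} {w0 : Date → ℝ}
    {S : α → Date → Matrix (Fin T) (Fin T) ℝ} {S0 : Date → Matrix (Fin T) (Fin T) ℝ}
    {c c' : α → Date → Fin T → ℝ} {c0 c0' : Date → Fin T → ℝ}
    (hw : ∀ g ∈ 𝒢, Tendsto (fun x => w x g) l (𝓝 (w0 g)))
    (hS : ∀ g ∈ 𝒢, ∀ t t', Tendsto (fun x => S x g t t') l (𝓝 (S0 g t t')))
    (hc : ∀ g ∈ 𝒢, ∀ t, Tendsto (fun x => c x g t) l (𝓝 (c0 g t)))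
    (hc' : ∀ g ∈ 𝒢, ∀ t, Tendsto (fun x => c' x g t) l (𝓝 (c0' g t))) :
    Tendsto (fun x => Qf 𝒢 (w x) (S x) (c x) (c' x)) l (𝓝 (Qf 𝒢 w0 S0 c0 c0')) := by
  unfold Qf bil
  refine tendsto_finsetSum _ fun g hg => (hw g hg).mul ?_
  refine tendsto_finsetSum _ fun t _ => tendsto_finsetSum _ fun t' _ => ?_
  exact ((hc g hg t).mul (hS g hg t t')).mul (hc' g hg t')

lemma tendsto_cB {α : Type*} {l : Filter α} (a : Fin T → Date → Date → ℝ)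
    (b : Fin M → Fin T → Date → Date → ℝ) {β : α → Fin M → ℝ} {β0 : Fin M → ℝ}
    (h : ∀ j, Tendsto (fun x => β x j) l (𝓝 (β0 j))) (g : Date) (t : Fin T) :
    Tendsto (fun x => cB 𝒢 a b (β x) g t) l (𝓝 (cB 𝒢 a b β0 g t)) := by
  unfold cB
  refine tendsto_const_nhds.sub (tendsto_finsetSum _ fun j _ => ?_)
  exact (h j).mul tendsto_const_nhds

lemma matX_apply (w : Date → ℝ) (S : Date → Matrix (Fin T) (Fin T) ℝ)
    (b : Fin M → Fin T → Date → Date → ℝ) (j k : Fin M) :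
    (∑ g ∈ 𝒢, w g • (A0 T M 𝒢 b g * S g * (A0 T M 𝒢 b g)ᵀ)) j k =
      Qf 𝒢 w S (Atheta T 𝒢 (b j)) (Atheta T 𝒢 (b k)) := by
  rw [Matrix.sum_apply]
  unfold Qf bil
  refine Finset.sum_congr rfl fun g _ => ?_
  rw [Matrix.smul_apply, smul_eq_mul]
  congr 1
  simp only [Matrix.mul_apply, Matrix.transpose_apply, Finset.sum_mul]
  rw [Finset.sum_comm]
  rfl

lemma vecX_apply (w : Date → ℝ) (S : Date → Matrix (Fin T) (Fin T) ℝ)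
    (a : Fin T → Date → Date → ℝ) (b : Fin M → Fin T → Date → Date → ℝ) (j : Fin M) :
    (∑ g ∈ 𝒢, w g • ((A0 T M 𝒢 b g * S g).mulVec (Atheta T 𝒢 a g))) j =
      Qf 𝒢 w S (Atheta T 𝒢 (b j)) (Atheta T 𝒢 a) := by
  rw [Finset.sum_apply]
  unfold Qf bil
  refine Finset.sum_congr rfl fun g _ => ?_
  rw [Pi.smul_apply, smul_eq_mul]
  congr 1
  simp only [Matrix.mul_apply, Matrix.mulVec, dotProduct, Finset.sum_mul]
  rw [Finset.sum_comm]
  rfl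

lemma Qf_symm (w : Date → ℝ) (S : Date → Matrix (Fin T) (Fin T) ℝ)
    (hS : ∀ g ∈ 𝒢, ∀ t t', S g t t' = S g t' t) (c c' : Date → Fin T → ℝ) :
    Qf 𝒢 w S c c' = Qf 𝒢 w S c' c := by
  unfold Qf bil
  refine Finset.sum_congr rfl fun g hg => ?_
  congr 1
  rw [Finset.sum_comm]
  refine Finset.sum_congr rfl fun t _ => Finset.sum_congr rfl fun t' _ => ?_
  rw [hS g hg t' t]; ring

lemma Qf_lin (w : Date → ℝ) (S : Date → Matrix (Fin T) (Fin T) ℝ) (c c' : Date → Fin T → ℝ) :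
    Qf 𝒢 w S c c' = ∑ g ∈ 𝒢, ∑ t, c g t * (w g * ∑ t', S g t t' * c' g t') := by
  unfold Qf bil
  refine Finset.sum_congr rfl fun g hg => ?_
  rw [Finset.mul_sum]
  refine Finset.sum_congr rfl fun t _ => ?_
  simp only [Finset.mul_sum]
  exact Finset.sum_congr rfl fun t' _ => by ring

lemma Qf_cB (w : Date → ℝ) (S : Date → Matrix (Fin T) (Fin T) ℝ)
    (a : Fin T → Date → Date → ℝ) (b : Fin M → Fin T → Date → Date → ℝ) (β : Fin M → ℝ)
    (c' : Date → Fin T → ℝ) :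
    Qf 𝒢 w S (cB 𝒢 a b β) c' = Qf 𝒢 w S (Atheta T 𝒢 a) c' -
      ∑ j, Qf 𝒢 w S (Atheta T 𝒢 (b j)) c' * β j := by
  simp only [Qf_lin]
  exact cB_sum 𝒢 a b β _

lemma sigma_eq (a : Fin T → Date → Date → ℝ) (b : Fin M → Fin T → Date → Date → ℝ)
    (p : Date → ℝ) (Sstar : Date → Matrix (Fin T) (Fin T) ℝ) (Sth : ℝ)
    (hSpd : ∀ g ∈ 𝒢, (Sstar g).PosDef) (hV : (VstarX T M 𝒢 b p Sstar).PosDef) :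
    Qf 𝒢 (fun g => (p g)⁻¹) Sstar
      (cB 𝒢 a b ((VstarX T M 𝒢 b p Sstar)⁻¹.mulVec (VstarXtheta T M 𝒢 a b p Sstar)))
      (cB 𝒢 a b ((VstarX T M 𝒢 b p Sstar)⁻¹.mulVec (VstarXtheta T M 𝒢 a b p Sstar))) - Sth =
    sigmaSqLim T M 𝒢 a b p Sstar Sth := by
  have hsym : ∀ g ∈ 𝒢, ∀ t t', Sstar g t t' = Sstar g t' t := by
    intro g hg t t'
    have := (hSpd g hg).isHermitian.apply t t'
    simpa using this.symm
  set V := VstarX T M 𝒢 b p Sstar with hVdef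
  set x := VstarXtheta T M 𝒢 a b p Sstar with hxdef
  set β := V⁻¹.mulVec x with hβ
  have hVβ : V.mulVec β = x := by
    rw [hβ, Matrix.mulVec_mulVec, Matrix.mul_nonsing_inv _ (hV.det_pos.ne'.isUnit),
      Matrix.one_mulVec]
  have hVe : ∀ j k, Qf 𝒢 (fun g => (p g)⁻¹) Sstar (Atheta T 𝒢 (b j)) (Atheta T 𝒢 (b k)) = V j k :=
    fun j k => (matX_apply _ _ b j k).symm
  have hxe : ∀ j, Qf 𝒢 (fun g => (p g)⁻¹) Sstar (Atheta T 𝒢 (b j)) (Atheta T 𝒢 a) = x j :=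
    fun j => (vecX_apply _ _ a b j).symm
  have hz : ∀ j, Qf 𝒢 (fun g => (p g)⁻¹) Sstar (Atheta T 𝒢 (b j)) (cB 𝒢 a b β) = 0 := by
    intro j
    rw [Qf_symm _ _ hsym, Qf_cB, Qf_symm _ _ hsym, hxe]
    simp_rw [Qf_symm _ _ hsym _ (Atheta T 𝒢 (b j)), hVe]
    have := congrFun hVβ j
    simp only [Matrix.mulVec, dotProduct] at this
    rw [this, sub_self]
  rw [Qf_cB, Finset.sum_congr rfl fun j _ => by rw [hz j, zero_mul], Finset.sum_const_zero,
    sub_zero, Qf_symm _ _ hsym, Qf_cB]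
  unfold sigmaSqLim VstarTheta
  simp only [hxe, ← hVdef, ← hxdef, ← hβ]
  simp only [Qf, bil_eq, dotProduct]
  ring

lemma inv_smul_mulVec {c : ℝ} (hc : c ≠ 0) (A : Matrix (Fin M) (Fin M) ℝ) (x : Fin M → ℝ) :
    (c • A)⁻¹.mulVec (c • x) = A⁻¹.mulVec x := by
  by_cases h : IsUnit A.det
  · have : (c • A)⁻¹ = c⁻¹ • A⁻¹ := by
      apply Matrix.inv_eq_right_inv
      rw [Matrix.smul_mul, Matrix.mul_smul, Matrix.mul_nonsing_inv _ h, smul_smul,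
        mul_inv_cancel₀ hc, one_smul]
    rw [this, Matrix.smul_mulVec, Matrix.mulVec_smul, smul_smul, inv_mul_cancel₀ hc, one_smul]
  · have h' : ¬ IsUnit (c • A).det := by
      rw [Matrix.det_smul]
      intro hu
      exact h (isUnit_of_mul_isUnit_right hu)
    rw [Matrix.nonsing_inv_apply_not_isUnit _ h, Matrix.nonsing_inv_apply_not_isUnit _ h']
    simp

lemma tendsto_inv_mulVec {α : Type*} {l : Filter α} {A : α → Matrix (Fin M) (Fin M) ℝ}
    {A0 : Matrix (Fin M) (Fin M) ℝ} {x : α → Fin M → ℝ} {x0 : Fin M → ℝ}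
    (hA : ∀ j k, Tendsto (fun y => A y j k) l (𝓝 (A0 j k)))
    (hx : ∀ j, Tendsto (fun y => x y j) l (𝓝 (x0 j))) (hdet : A0.det ≠ 0) (j : Fin M) :
    Tendsto (fun y => ((A y)⁻¹.mulVec (x y)) j) l (𝓝 ((A0⁻¹.mulVec x0) j)) := by
  have hA' : Tendsto A l (𝓝 A0) := by
    refine tendsto_pi_nhds.2 fun j => tendsto_pi_nhds.2 fun k => hA j k
  have hd : Tendsto (fun y => (A y).det) l (𝓝 A0.det) :=
    ((continuous_id.matrix_det).tendsto A0).comp hA'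
  have hadj : Tendsto (fun y => (A y).adjugate) l (𝓝 A0.adjugate) :=
    ((continuous_id.matrix_adjugate).tendsto A0).comp hA'
  have hinv : ∀ j k, Tendsto (fun y => (A y)⁻¹ j k) l (𝓝 (A0⁻¹ j k)) := by
    intro j k
    simp only [Matrix.inv_def, Ring.inverse_eq_inv', Matrix.smul_apply, smul_eq_mul]
    exact (hd.inv₀ hdet).mul (tendsto_pi_nhds.1 (tendsto_pi_nhds.1 hadj j) k)
  simp only [Matrix.mulVec, dotProduct]
  exact tendsto_finsetSum _ fun k _ => (hinv j k).mul (hx k)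

end limalg

end Staggered

namespace Staggered

/-! ### The oracle variance limit -/

section oracle

variable {T M : ℕ} {𝒢 : Finset Date}

lemma varE_eq_covE {N : ℕ} {Ng : Date → ℕ} (f : (Fin N → 𝒢) → ℝ) :
    varE N 𝒢 Ng f = covE N 𝒢 Ng f f := by
  unfold varE covE
  simp only [sq]

lemma tendsto_ratio {N : ℕ → ℕ} {Ng : ℕ → Date → ℕ} {p : Date → ℝ}
    (hp : ∀ g ∈ 𝒢, 0 < p g ∧ p g < 1)
    (hpconv : ∀ g ∈ 𝒢, Tendsto (fun m => (Ng m g : ℝ) / (N m : ℝ)) atTop (𝓝 (p g))) :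
    ∀ g ∈ 𝒢, Tendsto (fun m => (N m : ℝ) / (Ng m g : ℝ)) atTop (𝓝 ((p g)⁻¹)) := by
  intro g hg
  have := (hpconv g hg).inv₀ (hp g hg).1.ne'
  simpa [inv_div] using this

lemma oracle_limit
    (N : ℕ → ℕ) (Ng : ℕ → Date → ℕ)
    (Y : ∀ m, Fin (N m) → Date → Fin T → ℝ)
    (a : Fin T → Date → Date → ℝ) (b : Fin M → Fin T → Date → Date → ℝ)
    (p : Date → ℝ) (Sstar : Date → Matrix (Fin T) (Fin T) ℝ) (Sthetastar : ℝ)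
    (hN2 : ∀ m, 2 ≤ N m)
    (hNg : ∀ m, ∀ g ∈ 𝒢, 1 ≤ Ng m g) (hsum : ∀ m, ∑ g ∈ 𝒢, Ng m g = N m)
    (hna : ∀ m j i, ∑ g ∈ 𝒢, Atheta T 𝒢 (b j) g ⬝ᵥ Y m i g = 0)
    (hw : ∀ g ∈ 𝒢, Tendsto (fun m => (N m : ℝ) / (Ng m g : ℝ)) atTop (𝓝 ((p g)⁻¹)))
    (hSconv : ∀ g ∈ 𝒢, ∀ t t' : Fin T,
      Tendsto (fun m => Sg (N m) T (Y m) g t t') atTop (𝓝 (Sstar g t t')))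
    (hSpd : ∀ g ∈ 𝒢, (Sstar g).PosDef)
    (hSthetaconv : Tendsto (fun m => Stheta (N m) T 𝒢 (Y m) a) atTop (𝓝 Sthetastar))
    (hVXpd : (VstarX T M 𝒢 b p Sstar).PosDef) :
    Tendsto (fun m => (N m : ℝ) *
        varE (N m) 𝒢 (Ng m) (fun d =>
          thetaHat0 𝒢 (Ng m) a (obs (Y m) d) d -
            ∑ j, Xhat 𝒢 (Ng m) b (obs (Y m) d) d j *
              ((Matrix.of fun j' k : Fin M =>
                  covE (N m) 𝒢 (Ng m) (fun d' => Xhat 𝒢 (Ng m) b (obs (Y m) d') d' j')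
                    (fun d' => Xhat 𝒢 (Ng m) b (obs (Y m) d') d' k))⁻¹.mulVec
                (fun j' => covE (N m) 𝒢 (Ng m)
                  (fun d' => Xhat 𝒢 (Ng m) b (obs (Y m) d') d' j')
                  (fun d' => thetaHat0 𝒢 (Ng m) a (obs (Y m) d') d'))) j))
      atTop (𝓝 (sigmaSqLim T M 𝒢 a b p Sstar Sthetastar)) := by
  set w : ℕ → Date → ℝ := fun m g => (N m : ℝ) / (Ng m g : ℝ) with hwdef
  set A : ℕ → Matrix (Fin M) (Fin M) ℝ := fun m => (Matrix.of fun j' k : Fin M =>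
                  covE (N m) 𝒢 (Ng m) (fun d' => Xhat 𝒢 (Ng m) b (obs (Y m) d') d' j')
                    (fun d' => Xhat 𝒢 (Ng m) b (obs (Y m) d') d' k)) with hA
  set x : ℕ → Fin M → ℝ := fun m j' => covE (N m) 𝒢 (Ng m)
                  (fun d' => Xhat 𝒢 (Ng m) b (obs (Y m) d') d' j')
                  (fun d' => thetaHat0 𝒢 (Ng m) a (obs (Y m) d') d') with hx
  have hN0 : ∀ m, (N m : ℝ) ≠ 0 := fun m => by
    have := hN2 m
    positivity
  have hAe : ∀ m j k, ((N m : ℝ) • A m) j k =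
      Qf 𝒢 (w m) (Sg (N m) T (Y m)) (Atheta T 𝒢 (b j)) (Atheta T 𝒢 (b k)) := by
    intro m j k
    rw [Matrix.smul_apply, smul_eq_mul, hA]
    simp only [Matrix.of_apply, Xhat_eq]
    rw [covE_Lc (hN2 m) (hNg m) (hsum m), totC_zero _ _ _ (hna m j), sub_zero]
    rfl
  have hxe : ∀ m j, ((N m : ℝ) • x m) j =
      Qf 𝒢 (w m) (Sg (N m) T (Y m)) (Atheta T 𝒢 (b j)) (Atheta T 𝒢 a) := by
    intro m j
    rw [Pi.smul_apply, smul_eq_mul, hx]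
    simp only [Xhat_eq, thetaHat0_eq]
    rw [covE_Lc (hN2 m) (hNg m) (hsum m), totC_zero _ _ _ (hna m j), sub_zero]
    rfl
  have hβ : ∀ j, Tendsto (fun m => ((A m)⁻¹.mulVec (x m)) j) atTop
      (𝓝 (((VstarX T M 𝒢 b p Sstar)⁻¹.mulVec (VstarXtheta T M 𝒢 a b p Sstar)) j)) := by
    intro j
    simp_rw [← fun m => inv_smul_mulVec (hN0 m) (A m) (x m)]
    refine tendsto_inv_mulVec (fun j k => ?_) (fun j => ?_) hVXpd.det_pos.ne' j
    · simp_rw [hAe]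
      unfold VstarX
      rw [matX_apply]
      exact tendsto_Qf hw hSconv (fun _ _ _ => tendsto_const_nhds) (fun _ _ _ => tendsto_const_nhds)
    · simp_rw [hxe]
      unfold VstarXtheta
      rw [vecX_apply]
      exact tendsto_Qf hw hSconv (fun _ _ _ => tendsto_const_nhds) (fun _ _ _ => tendsto_const_nhds)
  have hval : ∀ m, (N m : ℝ) * varE (N m) 𝒢 (Ng m) (fun d =>
          thetaHat0 𝒢 (Ng m) a (obs (Y m) d) d -
            ∑ j, Xhat 𝒢 (Ng m) b (obs (Y m) d) d j * ((A m)⁻¹.mulVec (x m)) j) =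
      Qf 𝒢 (w m) (Sg (N m) T (Y m)) (cB 𝒢 a b ((A m)⁻¹.mulVec (x m)))
        (cB 𝒢 a b ((A m)⁻¹.mulVec (x m))) - Stheta (N m) T 𝒢 (Y m) a := by
    intro m
    simp_rw [← Lc_cB]
    rw [varE_eq_covE, covE_Lc (hN2 m) (hNg m) (hsum m), totC_cB _ _ _ _ (hna m)]
    rfl
  rw [← sigma_eq a b p Sstar Sthetastar hSpd hVXpd]
  refine Tendsto.congr (fun m => (hval m).symm) ?_
  refine Tendsto.sub ?_ hSthetaconv
  exact tendsto_Qf hw hSconv (fun g _ t => tendsto_cB a b hβ g t)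
    (fun g _ t => tendsto_cB a b hβ g t)

end oracle

end Staggered

namespace Staggered

/-! ### Central limit theorem for linear statistics -/

section cltlin

variable {T : ℕ} {𝒢 : Finset Date}

lemma dev_bound {N : ℕ → ℕ} {Y : ∀ m, Fin (N m) → Date → Fin T → ℝ} (hN2 : ∀ m, 2 ≤ N m)
    (hLind : ∀ ε > (0 : ℝ), ∀ᶠ m in atTop, ∀ (i : Fin (N m)), ∀ g ∈ 𝒢,
      (∑ t, (Y m i g t - popMeanS (N m) fun i' => Y m i' g t) ^ 2) / (N m : ℝ) < ε) :
    ∀ ε > (0 : ℝ), ∀ᶠ m in atTop, ∀ (i : Fin (N m)), ∀ g ∈ 𝒢, ∀ t,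
      |Y m i g t - popMeanV (N m) T (fun i => Y m i g) t| ≤ ε * Real.sqrt (N m) := by
  intro ε hε
  filter_upwards [hLind (ε ^ 2) (by positivity)] with m hm i g hg t
  have h := hm i g hg
  have hNpos : (0 : ℝ) < N m := by exact_mod_cast (by have := hN2 m; omega : 0 < N m)
  rw [div_lt_iff₀ hNpos] at h
  apply abs_le_of_sq_le_sq _ (by positivity)
  rw [mul_pow, Real.sq_sqrt hNpos.le]
  refine le_trans ?_ h.le
  exact Finset.single_le_sum (f := fun t => (Y m i g t - popMeanS (N m) fun i' => Y m i' g t) ^ 2)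
    (fun _ _ => sq_nonneg _) (Finset.mem_univ t)

lemma ratio_bound {N : ℕ → ℕ} {Ng : ℕ → Date → ℕ} {p : Date → ℝ}
    (hp : ∀ g ∈ 𝒢, 0 < p g ∧ p g < 1)
    (hw : ∀ g ∈ 𝒢, Tendsto (fun m => (N m : ℝ) / (Ng m g : ℝ)) atTop (𝓝 ((p g)⁻¹))) :
    ∃ L : ℝ, 0 < L ∧ ∀ᶠ m in atTop, ∀ g ∈ 𝒢, (N m : ℝ) / (Ng m g : ℝ) ≤ L := by
  have hnn : ∀ g ∈ 𝒢, 0 ≤ (p g)⁻¹ := fun g hg => (inv_pos.2 (hp g hg).1).le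
  refine ⟨∑ g ∈ 𝒢, (p g)⁻¹ + 1, by have := Finset.sum_nonneg hnn; linarith, ?_⟩
  rw [Filter.eventually_all_finset]
  intro g hg
  refine (hw g hg).eventually_le_const ?_
  have := Finset.single_le_sum hnn hg
  linarith

/-- The standardised combinatorial array. -/
def vArr {N : ℕ} (𝒢 : Finset Date) (Ng : Date → ℕ) (u : Fin N → Date → ℝ) (i : Fin N)
    (g : Date) : ℝ :=
  Real.sqrt N * (u i g / Ng g - (∑ h ∈ 𝒢, u i h) / N)

lemma vArr_row {N : ℕ} {Ng : Date → ℕ} (hN : 0 < N) (hNg : ∀ g ∈ 𝒢, 1 ≤ Ng g)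
    (hsum : ∑ g ∈ 𝒢, Ng g = N) (u : Fin N → Date → ℝ) (i : Fin N) :
    ∑ g ∈ 𝒢, (Ng g : ℝ) * vArr 𝒢 Ng u i g = 0 := by
  have hNpos : (0 : ℝ) < N := by exact_mod_cast hN
  have h1 : ∀ g ∈ 𝒢, (Ng g : ℝ) * vArr 𝒢 Ng u i g =
      Real.sqrt N * (u i g - Ng g * ((∑ h ∈ 𝒢, u i h) / N)) := by
    intro g hg
    have hg0 : (0 : ℝ) < Ng g := by exact_mod_cast hNg g hg
    unfold vArr
    field_simp
  rw [Finset.sum_congr rfl h1, ← Finset.mul_sum, Finset.sum_sub_distrib, ← Finset.sum_mul]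
  have : ∑ g ∈ 𝒢, (Ng g : ℝ) = N := by exact_mod_cast hsum
  rw [this]
  field_simp
  simp

lemma vArr_col {N : ℕ} {Ng : Date → ℕ} (u : Fin N → Date → ℝ) (hu : ∀ g, ∑ i, u i g = 0)
    (g : Date) : ∑ i, vArr 𝒢 Ng u i g = 0 := by
  unfold vArr
  rw [← Finset.mul_sum, Finset.sum_sub_distrib, ← Finset.sum_div, ← Finset.sum_div, hu,
    Finset.sum_comm]
  simp [hu]

lemma vArr_sq {N : ℕ} {Ng : Date → ℕ} (hN : 0 < N) (hNg : ∀ g ∈ 𝒢, 1 ≤ Ng g)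
    (hsum : ∑ g ∈ 𝒢, Ng g = N) (u : Fin N → Date → ℝ) :
    (∑ i, ∑ g ∈ 𝒢, (Ng g : ℝ) * vArr 𝒢 Ng u i g ^ 2) / (N : ℝ) =
      ∑ g ∈ 𝒢, (∑ i, u i g * u i g) / Ng g -
        (∑ i, (∑ h ∈ 𝒢, u i h) * (∑ h ∈ 𝒢, u i h)) / N := by
  have hNpos : (0 : ℝ) < N := by exact_mod_cast hN
  have hs : ∑ g ∈ 𝒢, (Ng g : ℝ) = N := by exact_mod_cast hsum
  have h1 : ∀ i, ∑ g ∈ 𝒢, (Ng g : ℝ) * vArr 𝒢 Ng u i g ^ 2 =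
      N * (∑ g ∈ 𝒢, u i g * u i g / Ng g - (∑ h ∈ 𝒢, u i h) * (∑ h ∈ 𝒢, u i h) / N) := by
    intro i
    have h2 : ∀ g ∈ 𝒢, (Ng g : ℝ) * vArr 𝒢 Ng u i g ^ 2 =
        N * (u i g * u i g / Ng g) - 2 * (∑ h ∈ 𝒢, u i h) * u i g +
          Ng g * ((∑ h ∈ 𝒢, u i h) ^ 2 / N) := by
      intro g hg
      have hg0 : (0 : ℝ) < Ng g := by exact_mod_cast hNg g hg
      unfold vArr
      rw [mul_pow, Real.sq_sqrt hNpos.le]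
      field_simp
      ring
    rw [Finset.sum_congr rfl h2, Finset.sum_add_distrib, Finset.sum_sub_distrib,
      ← Finset.sum_mul, ← Finset.mul_sum, ← Finset.mul_sum, hs]
    field_simp
    ring
  simp_rw [h1]
  rw [← Finset.mul_sum, mul_div_cancel_left₀ _ hNpos.ne']
  rw [Finset.sum_sub_distrib, Finset.sum_comm]
  simp_rw [Finset.sum_div]

lemma Wst_vArr {N : ℕ} {Ng : Date → ℕ} (u : Fin N → Date → ℝ) (hu : ∀ g, ∑ i, u i g = 0)
    (d : Fin N → 𝒢) :
    Wst (vArr 𝒢 Ng u) d =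
      Real.sqrt N * ∑ g ∈ 𝒢, (Ng g : ℝ)⁻¹ * Lin g (fun i => u i g) d := by
  unfold Wst vArr
  rw [← Finset.mul_sum, Finset.sum_sub_distrib, ← Finset.sum_div]
  rw [Finset.sum_comm (s := Finset.univ)]
  simp only [hu, Finset.sum_const_zero, zero_div, sub_zero]
  congr 1
  rw [sum_split (fun i g => u i g / (Ng g : ℝ)) d]
  refine Finset.sum_congr rfl fun g _ => ?_
  simp only [Lin_eq, Finset.mul_sum]
  exact Finset.sum_congr rfl fun i _ => by ring

lemma clt_Zc
    (N : ℕ → ℕ) (Ng : ℕ → Date → ℕ)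
    (Y : ∀ m, Fin (N m) → Date → Fin T → ℝ) (c : Date → Fin T → ℝ)
    (p : Date → ℝ) (Sstar : Date → Matrix (Fin T) (Fin T) ℝ) (Sth : ℝ)
    (hN2 : ∀ m, 2 ≤ N m) (hNtop : Tendsto N atTop atTop)
    (hNg : ∀ m, ∀ g ∈ 𝒢, 1 ≤ Ng m g) (hsum : ∀ m, ∑ g ∈ 𝒢, Ng m g = N m)
    (hp : ∀ g ∈ 𝒢, 0 < p g ∧ p g < 1)
    (hw : ∀ g ∈ 𝒢, Tendsto (fun m => (N m : ℝ) / (Ng m g : ℝ)) atTop (𝓝 ((p g)⁻¹)))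
    (hSconv : ∀ g ∈ 𝒢, ∀ t t' : Fin T,
      Tendsto (fun m => Sg (N m) T (Y m) g t t') atTop (𝓝 (Sstar g t t')))
    (hdev : ∀ ε > (0 : ℝ), ∀ᶠ m in atTop, ∀ (i : Fin (N m)), ∀ g ∈ 𝒢, ∀ t,
      |Y m i g t - popMeanV (N m) T (fun i => Y m i g) t| ≤ ε * Real.sqrt (N m))
    (htot : Tendsto (fun m => totC 𝒢 (Y m) c c) atTop (𝓝 Sth)) :
    0 ≤ Qf 𝒢 (fun g => (p g)⁻¹) Sstar c c - Sth ∧ ∀ t : ℝ,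
    Tendsto (fun m => EC (N m) 𝒢 (Ng m) (fun d => Complex.exp (Complex.I *
      (t * (Real.sqrt (N m) * Zc (Ng m) (Y m) c d) : ℝ))))
      atTop (𝓝 (Complex.exp (-((Qf 𝒢 (fun g => (p g)⁻¹) Sstar c c - Sth) * t ^ 2 / 2 : ℝ)))) := by
  set s := Qf 𝒢 (fun g => (p g)⁻¹) Sstar c c - Sth with hs
  have hNpos : ∀ m, (0 : ℝ) < N m := fun m => by
    exact_mod_cast (by have := hN2 m; omega : 0 < N m)
  have hN0 : ∀ m, 0 < N m := fun m => by have := hN2 m; omega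
  have hu : ∀ m g, ∑ i, uSc (Y m) c i g = 0 := fun m g => sum_uSc (hN0 m) (Y m) c g
  set v : ∀ m, Fin (N m) → Date → ℝ := fun m => vArr 𝒢 (Ng m) (uSc (Y m) c) with hv
  have hAeq : ∀ m, (∑ i, ∑ g ∈ 𝒢, Ng m g * v m i g ^ 2) / (N m : ℝ) =
      (1 - 1 / (N m : ℝ)) * (Qf 𝒢 (fun g => (N m : ℝ) / Ng m g) (Sg (N m) T (Y m)) c c
        - totC 𝒢 (Y m) c c) := by
    intro m
    have h1 : (0 : ℝ) < (N m : ℝ) - 1 := by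
      have : (2 : ℝ) ≤ N m := by exact_mod_cast hN2 m
      linarith
    have hNm := hNpos m
    rw [hv, vArr_sq (hN0 m) (hNg m) (hsum m)]
    unfold Qf totC
    rw [mul_sub, Finset.mul_sum]
    congr 1
    · refine Finset.sum_congr rfl fun g hg => ?_
      have hg0 : (0 : ℝ) < Ng m g := by exact_mod_cast hNg m g hg
      rw [← sum_uSc_mul]
      field_simp
    · field_simp
  have hNr : Tendsto (fun m => (N m : ℝ)) atTop atTop :=
    tendsto_natCast_atTop_atTop.comp hNtop
  have hA : Tendsto (fun m => (∑ i, ∑ g ∈ 𝒢, Ng m g * v m i g ^ 2) / (N m : ℝ)) atTop (𝓝 s) := by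
    simp_rw [hAeq]
    have h1 : Tendsto (fun m => 1 - 1 / (N m : ℝ)) atTop (𝓝 (1 - 0)) :=
      tendsto_const_nhds.sub (tendsto_const_nhds.div_atTop hNr)
    have h2 : Tendsto (fun m => Qf 𝒢 (fun g => (N m : ℝ) / Ng m g) (Sg (N m) T (Y m)) c c
        - totC 𝒢 (Y m) c c) atTop (𝓝 s) :=
      (tendsto_Qf (w := fun m g => (N m : ℝ) / Ng m g) (w0 := fun g => (p g)⁻¹)
        (S := fun m => Sg (N m) T (Y m)) (S0 := Sstar) (c := fun _ => c) (c' := fun _ => c)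
        (c0 := c) (c0' := c) hw hSconv (fun _ _ _ => tendsto_const_nhds)
        (fun _ _ _ => tendsto_const_nhds)).sub htot
    have h3 := h1.mul h2
    rw [sub_zero, one_mul] at h3
    exact h3
  refine ⟨ge_of_tendsto' hA fun m => by positivity, fun t => ?_⟩
  obtain ⟨L, hL0, hL⟩ := ratio_bound hp hw
  have hδ : ∀ ε > (0 : ℝ), ∀ᶠ m in atTop, ∀ i, ∀ g ∈ 𝒢, |v m i g| ≤ ε := by
    intro ε hε
    set κ : ℝ := ∑ g ∈ 𝒢, ∑ t, |c g t| with hκ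
    have hκ0 : 0 ≤ κ := by positivity
    set D : ℝ := κ * (L + (𝒢.card : ℝ)) + 1 with hD
    have hD0 : 0 < D := by positivity
    filter_upwards [hL, hdev (ε / D) (by positivity)] with m hLm hdm i g hg
    have hNm := hNpos m
    have hsq : 0 ≤ Real.sqrt (N m) := Real.sqrt_nonneg _
    have hub : ∀ h ∈ 𝒢, |uSc (Y m) c i h| ≤ κ * (ε / D * Real.sqrt (N m)) := by
      intro h hh
      unfold uSc
      refine (Finset.abs_sum_le_sum_abs _ _).trans ?_
      have : ∑ t, |c h t| ≤ κ :=
        Finset.single_le_sum (f := fun g => ∑ t, |c g t|) (fun _ _ => by positivity) hh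
      refine le_trans ?_ (mul_le_mul_of_nonneg_right this (by positivity))
      rw [Finset.sum_mul]
      refine Finset.sum_le_sum fun t _ => ?_
      rw [abs_mul]
      exact mul_le_mul_of_nonneg_left (hdm i h hh t) (abs_nonneg _)
    have hg0 : (0 : ℝ) < Ng m g := by exact_mod_cast hNg m g hg
    have hsumb : |∑ h ∈ 𝒢, uSc (Y m) c i h| ≤ (𝒢.card : ℝ) * (κ * (ε / D * Real.sqrt (N m))) := by
      refine (Finset.abs_sum_le_sum_abs _ _).trans ?_
      refine (Finset.sum_le_sum hub).trans ?_
      rw [Finset.sum_const, nsmul_eq_mul]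
    have h1 : |v m i g| ≤ Real.sqrt (N m) * ((κ * (ε / D * Real.sqrt (N m))) / Ng m g +
        (𝒢.card : ℝ) * (κ * (ε / D * Real.sqrt (N m))) / N m) := by
      simp only [hv, vArr]
      rw [abs_mul, abs_of_nonneg hsq]
      refine mul_le_mul_of_nonneg_left ?_ hsq
      refine (abs_sub _ _).trans ?_
      rw [abs_div, abs_div, abs_of_pos hg0, abs_of_pos hNm]
      gcongr
      exact hub g hg
    have h2 : Real.sqrt (N m) * ((κ * (ε / D * Real.sqrt (N m))) / Ng m g +
        (𝒢.card : ℝ) * (κ * (ε / D * Real.sqrt (N m))) / N m) =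
        (ε / D) * (κ * ((N m : ℝ) / Ng m g + (𝒢.card : ℝ))) := by
      have h3 : Real.sqrt (N m) * Real.sqrt (N m) = N m := Real.mul_self_sqrt hNm.le
      have h4 : Real.sqrt (N m) * ((κ * (ε / D * Real.sqrt (N m))) / Ng m g +
        (𝒢.card : ℝ) * (κ * (ε / D * Real.sqrt (N m))) / N m) =
        (ε / D) * (κ * ((Real.sqrt (N m) * Real.sqrt (N m)) / Ng m g +
          (𝒢.card : ℝ) * ((Real.sqrt (N m) * Real.sqrt (N m)) / N m))) := by ring
      rw [h4, h3, div_self hNm.ne', mul_one]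
    rw [h2] at h1
    refine h1.trans ?_
    have h5 : κ * ((N m : ℝ) / Ng m g + (𝒢.card : ℝ)) ≤ D := by
      have := mul_le_mul_of_nonneg_left (add_le_add_left (hLm g hg) (𝒢.card : ℝ)) hκ0
      rw [hD]; linarith
    calc (ε / D) * (κ * ((N m : ℝ) / Ng m g + (𝒢.card : ℝ))) ≤ (ε / D) * D :=
          mul_le_mul_of_nonneg_left h5 (by positivity)
      _ = ε := by field_simp
  have hC : ∀ᶠ m in atTop, ∀ g ∈ 𝒢, ∑ i, v m i g ^ 2 ≤ L * (s + 1) := by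
    filter_upwards [hL, hA.eventually_le_const (lt_add_one s)] with m hLm hAm g hg
    have hNm := hNpos m
    have hg0 : (0 : ℝ) < Ng m g := by exact_mod_cast hNg m g hg
    have h1 : (Ng m g : ℝ) * ∑ i, v m i g ^ 2 ≤ ∑ i, ∑ g ∈ 𝒢, Ng m g * v m i g ^ 2 := by
      rw [Finset.mul_sum]
      refine Finset.sum_le_sum fun i _ => ?_
      exact Finset.single_le_sum (f := fun g => (Ng m g : ℝ) * v m i g ^ 2)
        (fun _ _ => by positivity) hg
    have h2 : ∑ i, v m i g ^ 2 ≤ ((N m : ℝ) / Ng m g) *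
        ((∑ i, ∑ g ∈ 𝒢, Ng m g * v m i g ^ 2) / (N m : ℝ)) := by
      rw [div_mul_div_comm, mul_comm (N m : ℝ), mul_div_mul_right _ _ hNm.ne', le_div_iff₀ hg0]
      linarith
    refine h2.trans ?_
    exact mul_le_mul (hLm g hg) hAm (by positivity) hL0.le
  have := clt_charFun 𝒢 N Ng v hN2 hNtop hNg hsum
    (fun m i => vArr_row (hN0 m) (hNg m) (hsum m) _ i)
    (fun m g _ => vArr_col _ (hu m) g) hδ (L * (s + 1)) hC s hA t
  refine this.congr fun m => ?_
  apply EC_congr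
  intro d _
  rw [hv, Wst_vArr _ (hu m)]
  rfl

end cltlin

end Staggered

namespace Staggered

/-! ### Consistency of the within-cohort sample covariances -/

section shat

variable {T : ℕ} {𝒢 : Finset Date}

/-- Centred potential outcome. -/
def dv {N : ℕ} (Y : Fin N → Date → Fin T → ℝ) (g : Date) (t : Fin T) (i : Fin N) : ℝ :=
  Y i g t - popMeanV N T (fun i => Y i g) t

lemma Lin_add {N : ℕ} (g : Date) (x y : Fin N → ℝ) (d : Fin N → 𝒢) :
    Lin g (fun i => x i + y i) d = Lin g x d + Lin g y d := by
  simp only [Lin_eq, add_mul, Finset.sum_add_distrib]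

lemma Lin_const_mul {N : ℕ} (g : Date) (c : ℝ) (x : Fin N → ℝ) (d : Fin N → 𝒢) :
    Lin g (fun i => c * x i) d = c * Lin g x d := by
  simp only [Lin_eq, mul_assoc, ← Finset.mul_sum]

lemma Shat_eq {N : ℕ} {Ng : Date → ℕ} (hNg : ∀ g ∈ 𝒢, 1 ≤ Ng g)
    (Y : Fin N → Date → Fin T → ℝ) {d : Fin N → 𝒢} (hd : d ∈ assigns N 𝒢 Ng) {g : Date}
    (hg : g ∈ 𝒢) (t t' : Fin T) :
    Shat Ng (obs Y d) d g t t' =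
      (Lin g (fun i => dv Y g t i * dv Y g t' i) d / Ng g -
        (Lin g (dv Y g t) d / Ng g) * (Lin g (dv Y g t') d / Ng g)) *
      ((Ng g : ℝ) / ((Ng g : ℝ) - 1)) := by
  have hg0 : (0 : ℝ) < Ng g := by exact_mod_cast hNg g hg
  have hcm : ∀ s, cmean Ng (obs Y d) d g s =
      popMeanV N T (fun i => Y i g) s + Lin g (dv Y g s) d / Ng g := by
    intro s
    have h1 : Lin g (dv Y g s) d = Lin g (fun i => Y i g s) d -
        Ng g * popMeanV N T (fun i => Y i g) s := by
      unfold dv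
      rw [Lin_sub, Lin_const hd hg]
    rw [cmean_obs, h1]
    field_simp
    ring
  set A := Lin g (dv Y g t) d / Ng g with hA
  set B := Lin g (dv Y g t') d / Ng g with hB
  have hnum : (∑ i, if (d i : Date) = g then
      (obs Y d i t - cmean Ng (obs Y d) d g t) * (obs Y d i t' - cmean Ng (obs Y d) d g t') else 0)
      = Lin g (fun i => (dv Y g t i * dv Y g t' i - (A * dv Y g t' i + B * dv Y g t i)) + A * B) d := by
    unfold Lin
    refine Finset.sum_congr rfl fun i _ => ?_
    split_ifs with h
    · rw [hcm, hcm, ← hA, ← hB]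
      unfold obs dv
      rw [h]; ring
    · rfl
  have hnum2 : Lin g (fun i => (dv Y g t i * dv Y g t' i - (A * dv Y g t' i + B * dv Y g t i))
      + A * B) d = Lin g (fun i => dv Y g t i * dv Y g t' i) d - Ng g * (A * B) := by
    rw [Lin_add, Lin_sub, Lin_add, Lin_const_mul, Lin_const_mul, Lin_const hd hg]
    have h1 : Lin g (dv Y g t) d = Ng g * A := by rw [hA]; field_simp
    have h2 : Lin g (dv Y g t') d = Ng g * B := by rw [hB]; field_simp
    have h1' : Lin g (fun i => dv Y g t i) d = Ng g * A := h1
    have h2' : Lin g (fun i => dv Y g t' i) d = Ng g * B := h2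
    rw [h1', h2']
    ring
  unfold Shat
  rw [Matrix.of_apply, hnum, hnum2]
  by_cases h1 : (Ng g : ℝ) - 1 = 0
  · rw [h1]; simp
  · field_simp

lemma sum_dv_mul {N : ℕ} (hN : 2 ≤ N) (Y : Fin N → Date → Fin T → ℝ) (g : Date) (t t' : Fin T) :
    ∑ i, dv Y g t i * dv Y g t' i = ((N : ℝ) - 1) * Sg N T Y g t t' := by
  have h1 : (0 : ℝ) < (N : ℝ) - 1 := by
    have : (2 : ℝ) ≤ N := by exact_mod_cast hN
    linarith
  unfold Sg popCov dv
  rw [Matrix.of_apply]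
  field_simp

lemma expec_Lin_div_sq {N : ℕ} {Ng : Date → ℕ} (hN : 2 ≤ N) (hNg : ∀ g ∈ 𝒢, 1 ≤ Ng g)
    (hsum : ∑ g ∈ 𝒢, Ng g = N) {g : Date} (hg : g ∈ 𝒢) (x : Fin N → ℝ) (hx : ∑ i, x i = 0) :
    expec N 𝒢 Ng (fun d => (Lin g x d / Ng g) ^ 2) ≤
      ((N : ℝ) / Ng g) ^ 2 * ((∑ i, x i ^ 2) / (N : ℝ) ^ 2) := by
  have hNpos : (0 : ℝ) < N := by exact_mod_cast (by omega : 0 < N)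
  have hg0 : (0 : ℝ) < Ng g := by exact_mod_cast hNg g hg
  have h1 : ∀ d : Fin N → 𝒢, (Lin g x d / Ng g) ^ 2 = ((Ng g : ℝ)⁻¹) ^ 2 * Lin g x d ^ 2 :=
    fun d => by ring
  simp_rw [h1]
  rw [expec_const_mul]
  refine (mul_le_mul_of_nonneg_left (expec_Lin_sq_le hN hNg hsum hg x hx) (by positivity)).trans
    (le_of_eq ?_)
  field_simp

lemma Shat_tendsto
    (N : ℕ → ℕ) (Ng : ℕ → Date → ℕ)
    (Y : ∀ m, Fin (N m) → Date → Fin T → ℝ)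
    (p : Date → ℝ) (Sstar : Date → Matrix (Fin T) (Fin T) ℝ)
    (hN2 : ∀ m, 2 ≤ N m) (hNtop : Tendsto N atTop atTop)
    (hNg : ∀ m, ∀ g ∈ 𝒢, 1 ≤ Ng m g) (hsum : ∀ m, ∑ g ∈ 𝒢, Ng m g = N m)
    (hw : ∀ g ∈ 𝒢, Tendsto (fun m => (N m : ℝ) / (Ng m g : ℝ)) atTop (𝓝 ((p g)⁻¹)))
    (hSconv : ∀ g ∈ 𝒢, ∀ t t' : Fin T,
      Tendsto (fun m => Sg (N m) T (Y m) g t t') atTop (𝓝 (Sstar g t t')))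
    (hdev : ∀ ε > (0 : ℝ), ∀ᶠ m in atTop, ∀ (i : Fin (N m)), ∀ g ∈ 𝒢, ∀ t,
      |Y m i g t - popMeanV (N m) T (fun i => Y m i g) t| ≤ ε * Real.sqrt (N m))
    (g : Date) (hg : g ∈ 𝒢) (t t' : Fin T) :
    Tendsto (fun x : Σ m, (Fin (N m) → 𝒢) => Shat (Ng x.1) (obs (Y x.1) x.2) x.2 g t t')
      (pF N 𝒢 Ng) (𝓝 (Sstar g t t')) := by
  have hNpos : ∀ m, (0 : ℝ) < N m := fun m => by
    exact_mod_cast (by have := hN2 m; omega : 0 < N m)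
  have hN0 : ∀ m, 0 < N m := fun m => by have := hN2 m; omega
  have hNr : Tendsto (fun m => (N m : ℝ)) atTop atTop :=
    tendsto_natCast_atTop_atTop.comp hNtop
  have hinvN : Tendsto (fun m => 1 / (N m : ℝ)) atTop (𝓝 0) := tendsto_const_nhds.div_atTop hNr
  have hdvsum : ∀ m s, ∑ i, dv (Y m) g s i = 0 := fun m s =>
    sum_centred (hN0 m) (fun i => Y m i g) s
  have hg0 : ∀ m, (0 : ℝ) < Ng m g := fun m => by exact_mod_cast hNg m g hg
  -- cohort means of deviations vanish
  have hbar : ∀ s : Fin T, Tendsto (fun x : Σ m, (Fin (N m) → 𝒢) =>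
      Lin g (dv (Y x.1) g s) x.2 / Ng x.1 g) (pF N 𝒢 Ng) (𝓝 0) := by
    intro s
    apply tendsto_pF_of_sq (fun m d => Lin g (dv (Y m) g s) d / Ng m g)
    have hlim : Tendsto (fun m => ((N m : ℝ) / Ng m g) ^ 2 * (Sg (N m) T (Y m) g s s * (1 / (N m : ℝ))))
        atTop (𝓝 (((p g)⁻¹) ^ 2 * (Sstar g s s * 0))) :=
      ((hw g hg).pow 2).mul ((hSconv g hg s s).mul hinvN)
    rw [mul_zero, mul_zero] at hlim
    refine squeeze_zero (fun m => expec_nonneg fun d _ => sq_nonneg _) (fun m => ?_) hlim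
    refine (expec_Lin_div_sq (hN2 m) (hNg m) (hsum m) hg _ (hdvsum m s)).trans ?_
    refine mul_le_mul_of_nonneg_left ?_ (by positivity)
    have h1 : ∑ i, dv (Y m) g s i ^ 2 = ((N m : ℝ) - 1) * Sg (N m) T (Y m) g s s := by
      rw [← sum_dv_mul (hN2 m)]
      exact Finset.sum_congr rfl fun i _ => by ring
    have h3 : (0 : ℝ) < (N m : ℝ) - 1 := by
      have : (2 : ℝ) ≤ N m := by exact_mod_cast hN2 m
      linarith
    have h2 : 0 ≤ Sg (N m) T (Y m) g s s := by
      have : 0 ≤ ((N m : ℝ) - 1) * Sg (N m) T (Y m) g s s := by rw [← h1]; positivity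
      exact nonneg_of_mul_nonneg_right this h3
    have hNm := hNpos m
    rw [h1, div_le_iff₀ (by positivity)]
    have h4 : Sg (N m) T (Y m) g s s * (1 / (N m : ℝ)) * (N m : ℝ) ^ 2 =
        (N m : ℝ) * Sg (N m) T (Y m) g s s := by field_simp
    rw [h4]
    nlinarith
  -- cohort means of products
  have hprod : Tendsto (fun x : Σ m, (Fin (N m) → 𝒢) =>
      Lin g (fun i => dv (Y x.1) g t i * dv (Y x.1) g t' i) x.2 / Ng x.1 g)
      (pF N 𝒢 Ng) (𝓝 (Sstar g t t')) := by
    set zb : ℕ → ℝ := fun m => (1 - 1 / (N m : ℝ)) * Sg (N m) T (Y m) g t t' with hzb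
    have hzbe : ∀ m, (N m : ℝ) * zb m = ∑ i, dv (Y m) g t i * dv (Y m) g t' i := by
      intro m
      have hNm := hNpos m
      rw [sum_dv_mul (hN2 m), hzb]
      field_simp
    have hzlim : Tendsto zb atTop (𝓝 (Sstar g t t')) := by
      have h1 : Tendsto (fun m => 1 - 1 / (N m : ℝ)) atTop (𝓝 (1 - 0)) :=
        tendsto_const_nhds.sub hinvN
      have h3 := h1.mul (hSconv g hg t t')
      rw [sub_zero, one_mul] at h3
      exact h3
    have hR : Tendsto (fun x : Σ m, (Fin (N m) → 𝒢) =>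
        Lin g (fun i => dv (Y x.1) g t i * dv (Y x.1) g t' i - zb x.1) x.2 / Ng x.1 g)
        (pF N 𝒢 Ng) (𝓝 0) := by
      apply tendsto_pF_of_sq
        (fun m d => Lin g (fun i => dv (Y m) g t i * dv (Y m) g t' i - zb m) d / Ng m g)
      have hlim : Tendsto (fun m => ((N m : ℝ) / Ng m g) ^ 2 * Sg (N m) T (Y m) g t' t')
          atTop (𝓝 (((p g)⁻¹) ^ 2 * Sstar g t' t')) :=
        ((hw g hg).pow 2).mul (hSconv g hg t' t')
      set q := ((p g)⁻¹) ^ 2 * Sstar g t' t' with hq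
      rw [Metric.tendsto_nhds]
      intro ε hε
      have hq1 : 0 < |q| + 1 := by positivity
      set δ := ε / (2 * (|q| + 1)) with hδ
      have hδ0 : 0 < δ := by positivity
      filter_upwards [hdev (Real.sqrt δ) (Real.sqrt_pos.2 hδ0),
        hlim.eventually_le_const (lt_of_le_of_lt (le_abs_self q) (lt_add_one _))] with m hm hm2
      rw [Real.dist_eq, sub_zero, abs_of_nonneg (expec_nonneg fun d _ => sq_nonneg _)]
      have hNm := hNpos m
      have hz0 : ∑ i, (dv (Y m) g t i * dv (Y m) g t' i - zb m) = 0 := by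
        rw [Finset.sum_sub_distrib, ← hzbe]
        simp
      have hsq : ∑ i, (dv (Y m) g t i * dv (Y m) g t' i) ^ 2 ≤
          δ * (N m) * (((N m : ℝ) - 1) * Sg (N m) T (Y m) g t' t') := by
        rw [← sum_dv_mul (hN2 m), Finset.mul_sum]
        refine Finset.sum_le_sum fun i _ => ?_
        have h1 : dv (Y m) g t i ^ 2 ≤ δ * N m := by
          have h2 := hm i g hg t
          have h3 := pow_le_pow_left₀ (abs_nonneg _) h2 2
          rw [sq_abs, mul_pow, Real.sq_sqrt hδ0.le, Real.sq_sqrt hNm.le] at h3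
          exact h3
        rw [mul_pow, sq (dv (Y m) g t' i)]
        exact mul_le_mul_of_nonneg_right h1 (mul_self_nonneg _)
      have h1 : ∑ i, dv (Y m) g t' i * dv (Y m) g t' i = ((N m : ℝ) - 1) * Sg (N m) T (Y m) g t' t' :=
        sum_dv_mul (hN2 m) _ _ _ _
      have h3 : (0 : ℝ) < (N m : ℝ) - 1 := by
        have : (2 : ℝ) ≤ N m := by exact_mod_cast hN2 m
        linarith
      have h2 : 0 ≤ Sg (N m) T (Y m) g t' t' := by
        have : 0 ≤ ((N m : ℝ) - 1) * Sg (N m) T (Y m) g t' t' := by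
          rw [← h1]; exact Finset.sum_nonneg fun i _ => mul_self_nonneg _
        exact nonneg_of_mul_nonneg_right this h3
      have hbd : (∑ i, (dv (Y m) g t i * dv (Y m) g t' i - zb m) ^ 2) / (N m : ℝ) ^ 2 ≤
          δ * Sg (N m) T (Y m) g t' t' := by
        rw [div_le_iff₀ (by positivity)]
        refine (sum_sq_centre_le _ _ (hzbe m)).trans (hsq.trans ?_)
        have : 0 ≤ δ * N m * Sg (N m) T (Y m) g t' t' := by positivity
        nlinarith
      calc _ ≤ ((N m : ℝ) / Ng m g) ^ 2 * ((∑ i, (dv (Y m) g t i * dv (Y m) g t' i - zb m) ^ 2) /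
              (N m : ℝ) ^ 2) := expec_Lin_div_sq (hN2 m) (hNg m) (hsum m) hg _ hz0
        _ ≤ ((N m : ℝ) / Ng m g) ^ 2 * (δ * Sg (N m) T (Y m) g t' t') :=
            mul_le_mul_of_nonneg_left hbd (by positivity)
        _ = δ * (((N m : ℝ) / Ng m g) ^ 2 * Sg (N m) T (Y m) g t' t') := by ring
        _ ≤ δ * (|q| + 1) := mul_le_mul_of_nonneg_left hm2 hδ0.le
        _ = ε / 2 := by rw [hδ]; field_simp
        _ < ε := by linarith
    have h2 := (hzlim.comp (tendsto_fst_pF (N := N) (𝒢 := 𝒢) (Ng := Ng))).add hR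
    rw [add_zero] at h2
    refine h2.congr' ?_
    filter_upwards [eventually_mem_pF] with x hx
    rw [Function.comp_apply, Lin_sub, Lin_const hx hg]
    have := hg0 x.1
    field_simp
    ring
  have hcorr : Tendsto (fun m => (Ng m g : ℝ) / ((Ng m g : ℝ) - 1)) atTop (𝓝 1) := by
    have h1 : Tendsto (fun m => ((N m : ℝ) / Ng m g) * (1 / (N m : ℝ))) atTop (𝓝 ((p g)⁻¹ * 0)) :=
      (hw g hg).mul hinvN
    rw [mul_zero] at h1
    have h2 : Tendsto (fun m => (1 - ((N m : ℝ) / Ng m g) * (1 / (N m : ℝ)))⁻¹) atTop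
        (𝓝 ((1 - 0 : ℝ)⁻¹)) := (tendsto_const_nhds.sub h1).inv₀ (by norm_num)
    rw [sub_zero, inv_one] at h2
    refine h2.congr fun m => ?_
    have hNm := hNpos m
    have := hg0 m
    rw [← inv_div]
    field_simp
  have hfin := (hprod.sub ((hbar t).mul (hbar t'))).mul
    (hcorr.comp (tendsto_fst_pF (N := N) (𝒢 := 𝒢) (Ng := Ng)))
  rw [mul_zero, sub_zero, mul_one] at hfin
  refine hfin.congr' ?_
  filter_upwards [eventually_mem_pF] with x hx
  rw [Shat_eq (hNg x.1) (Y x.1) hx hg]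
  rfl

end shat

end Staggered

namespace Staggered

/-! ### The plug-in estimator -/

section plugin

variable {T M : ℕ} {𝒢 : Finset Date}

lemma Qf_scale (n : ℝ) (r : Date → ℝ) (S : Date → Matrix (Fin T) (Fin T) ℝ)
    (c c' : Date → Fin T → ℝ) :
    n * Qf 𝒢 (fun g => (r g)⁻¹) S c c' = Qf 𝒢 (fun g => n / r g) S c c' := by
  unfold Qf
  rw [Finset.mul_sum]
  exact Finset.sum_congr rfl fun g _ => by ring

lemma betaHat_tendsto
    (N : ℕ → ℕ) (Ng : ℕ → Date → ℕ)
    (Y : ∀ m, Fin (N m) → Date → Fin T → ℝ)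
    (a : Fin T → Date → Date → ℝ) (b : Fin M → Fin T → Date → Date → ℝ)
    (p : Date → ℝ) (Sstar : Date → Matrix (Fin T) (Fin T) ℝ)
    (hN2 : ∀ m, 2 ≤ N m)
    (hw : ∀ g ∈ 𝒢, Tendsto (fun m => (N m : ℝ) / (Ng m g : ℝ)) atTop (𝓝 ((p g)⁻¹)))
    (hShat : ∀ g ∈ 𝒢, ∀ t t' : Fin T,
      Tendsto (fun x : Σ m, (Fin (N m) → 𝒢) => Shat (Ng x.1) (obs (Y x.1) x.2) x.2 g t t')
      (pF N 𝒢 Ng) (𝓝 (Sstar g t t')))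
    (hVXpd : (VstarX T M 𝒢 b p Sstar).PosDef) (j : Fin M) :
    Tendsto (fun x : Σ m, (Fin (N m) → 𝒢) =>
        betaHatStar 𝒢 (Ng x.1) a b (obs (Y x.1) x.2) x.2 j) (pF N 𝒢 Ng)
      (𝓝 (((VstarX T M 𝒢 b p Sstar)⁻¹.mulVec (VstarXtheta T M 𝒢 a b p Sstar)) j)) := by
  have hN0 : ∀ m, (N m : ℝ) ≠ 0 := fun m => by
    have := hN2 m
    positivity
  have hw' : ∀ g ∈ 𝒢, Tendsto (fun x : Σ m, (Fin (N m) → 𝒢) => (N x.1 : ℝ) / (Ng x.1 g : ℝ))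
      (pF N 𝒢 Ng) (𝓝 ((p g)⁻¹)) := fun g hg =>
    (hw g hg).comp (tendsto_fst_pF (N := N) (𝒢 := 𝒢) (Ng := Ng))
  unfold betaHatStar
  simp_rw [← fun x : Σ m, (Fin (N m) → 𝒢) => inv_smul_mulVec (hN0 x.1)
    (VhatX 𝒢 (Ng x.1) b (obs (Y x.1) x.2) x.2) (VhatXtheta 𝒢 (Ng x.1) a b (obs (Y x.1) x.2) x.2)]
  refine tendsto_inv_mulVec (fun j k => ?_) (fun j => ?_) hVXpd.det_pos.ne' j
  · have h : ∀ x : Σ m, (Fin (N m) → 𝒢),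
        ((N x.1 : ℝ) • VhatX 𝒢 (Ng x.1) b (obs (Y x.1) x.2) x.2) j k =
        Qf 𝒢 (fun g => (N x.1 : ℝ) / (Ng x.1 g : ℝ)) (Shat (Ng x.1) (obs (Y x.1) x.2) x.2)
          (Atheta T 𝒢 (b j)) (Atheta T 𝒢 (b k)) := by
      intro x
      rw [Matrix.smul_apply, smul_eq_mul, ← Qf_scale]
      unfold VhatX
      rw [matX_apply]
    simp_rw [h]
    unfold VstarX
    rw [matX_apply]
    exact tendsto_Qf (w := fun (x : Σ m, (Fin (N m) → 𝒢)) g => (N x.1 : ℝ) / (Ng x.1 g : ℝ))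
      (S := fun (x : Σ m, (Fin (N m) → 𝒢)) => Shat (Ng x.1) (obs (Y x.1) x.2) x.2)
      (c := fun _ => Atheta T 𝒢 (b j)) (c' := fun _ => Atheta T 𝒢 (b k)) hw' hShat
      (fun _ _ _ => tendsto_const_nhds) (fun _ _ _ => tendsto_const_nhds)
  · have h : ∀ x : Σ m, (Fin (N m) → 𝒢),
        ((N x.1 : ℝ) • VhatXtheta 𝒢 (Ng x.1) a b (obs (Y x.1) x.2) x.2) j =
        Qf 𝒢 (fun g => (N x.1 : ℝ) / (Ng x.1 g : ℝ)) (Shat (Ng x.1) (obs (Y x.1) x.2) x.2)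
          (Atheta T 𝒢 (b j)) (Atheta T 𝒢 a) := by
      intro x
      rw [Pi.smul_apply, smul_eq_mul, ← Qf_scale]
      unfold VhatXtheta
      rw [vecX_apply]
    simp_rw [h]
    unfold VstarXtheta
    rw [vecX_apply]
    exact tendsto_Qf (w := fun (x : Σ m, (Fin (N m) → 𝒢)) g => (N x.1 : ℝ) / (Ng x.1 g : ℝ))
      (S := fun (x : Σ m, (Fin (N m) → 𝒢)) => Shat (Ng x.1) (obs (Y x.1) x.2) x.2)
      (c := fun _ => Atheta T 𝒢 (b j)) (c' := fun _ => Atheta T 𝒢 a) hw' hShat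
      (fun _ _ _ => tendsto_const_nhds) (fun _ _ _ => tendsto_const_nhds)

lemma plugin_clt
    (N : ℕ → ℕ) (Ng : ℕ → Date → ℕ)
    (Y : ∀ m, Fin (N m) → Date → Fin T → ℝ)
    (a : Fin T → Date → Date → ℝ) (b : Fin M → Fin T → Date → Date → ℝ)
    (p : Date → ℝ) (Sstar : Date → Matrix (Fin T) (Fin T) ℝ) (Sthetastar : ℝ)
    (hN2 : ∀ m, 2 ≤ N m) (hNtop : Tendsto N atTop atTop)
    (hNg : ∀ m, ∀ g ∈ 𝒢, 1 ≤ Ng m g) (hsum : ∀ m, ∑ g ∈ 𝒢, Ng m g = N m)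
    (hna : ∀ m j i, ∑ g ∈ 𝒢, Atheta T 𝒢 (b j) g ⬝ᵥ Y m i g = 0)
    (hp : ∀ g ∈ 𝒢, 0 < p g ∧ p g < 1)
    (hw : ∀ g ∈ 𝒢, Tendsto (fun m => (N m : ℝ) / (Ng m g : ℝ)) atTop (𝓝 ((p g)⁻¹)))
    (hSconv : ∀ g ∈ 𝒢, ∀ t t' : Fin T,
      Tendsto (fun m => Sg (N m) T (Y m) g t t') atTop (𝓝 (Sstar g t t')))
    (hSpd : ∀ g ∈ 𝒢, (Sstar g).PosDef)
    (hdev : ∀ ε > (0 : ℝ), ∀ᶠ m in atTop, ∀ (i : Fin (N m)), ∀ g ∈ 𝒢, ∀ t,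
      |Y m i g t - popMeanV (N m) T (fun i => Y m i g) t| ≤ ε * Real.sqrt (N m))
    (hSthetaconv : Tendsto (fun m => Stheta (N m) T 𝒢 (Y m) a) atTop (𝓝 Sthetastar))
    (hVXpd : (VstarX T M 𝒢 b p Sstar).PosDef)
    (f : ℝ → ℝ) (hf : Continuous f) (hfb : IsBounded f) :
      Tendsto (fun m => expec (N m) 𝒢 (Ng m) fun d =>
          f (Real.sqrt (N m : ℝ) *
            (thetaHatPlug 𝒢 (Ng m) a b (obs (Y m) d) d - thetaParam (N m) T 𝒢 (Y m) a)))
        atTop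
        (𝓝 (∫ x, f x ∂(gaussianReal 0
          (Real.toNNReal (sigmaSqLim T M 𝒢 a b p Sstar Sthetastar))))) := by
  have hNpos : ∀ m, (0 : ℝ) < N m := fun m => by
    exact_mod_cast (by have := hN2 m; omega : 0 < N m)
  set β : Fin M → ℝ := (VstarX T M 𝒢 b p Sstar)⁻¹.mulVec (VstarXtheta T M 𝒢 a b p Sstar) with hβ
  have hβhat := fun j => betaHat_tendsto N Ng Y a b p Sstar hN2 hw
    (Shat_tendsto N Ng Y p Sstar hN2 hNtop hNg hsum hw hSconv hdev) hVXpd j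
  have htot : Tendsto (fun m => totC 𝒢 (Y m) (cB 𝒢 a b β) (cB 𝒢 a b β)) atTop (𝓝 Sthetastar) := by
    simp_rw [fun m => totC_cB a b β (Y m) (hna m)]
    exact hSthetaconv
  have hclt := clt_Zc N Ng Y (cB 𝒢 a b β) p Sstar Sthetastar hN2 hNtop hNg hsum hp hw hSconv hdev htot
  rw [sigma_eq a b p Sstar Sthetastar hSpd hVXpd] at hclt
  obtain ⟨hs, hclt⟩ := hclt
  set R : ∀ m, (Fin (N m) → 𝒢) → ℝ := fun m d =>
    ∑ j, (Real.sqrt (N m) * Zc (Ng m) (Y m) (Atheta T 𝒢 (b j)) d) *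
      (β j - betaHatStar 𝒢 (Ng m) a b (obs (Y m) d) d j) with hR
  have hRlim : Tendsto (fun x => R x.1 x.2) (pF N 𝒢 Ng) (𝓝 0) := by
    rw [← Finset.sum_const_zero (s := (Finset.univ : Finset (Fin M)))]
    refine tendsto_finsetSum _ fun j _ => ?_
    have hQ : Tendsto (fun m => Qf 𝒢 (fun g => (N m : ℝ) / Ng m g) (Sg (N m) T (Y m))
        (Atheta T 𝒢 (b j)) (Atheta T 𝒢 (b j))) atTop (𝓝 (Qf 𝒢 (fun g => (p g)⁻¹) Sstar
        (Atheta T 𝒢 (b j)) (Atheta T 𝒢 (b j)))) :=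
      tendsto_Qf (w := fun m g => (N m : ℝ) / Ng m g) (S := fun m => Sg (N m) T (Y m))
        (c := fun _ => Atheta T 𝒢 (b j)) (c' := fun _ => Atheta T 𝒢 (b j)) hw hSconv
        (fun _ _ _ => tendsto_const_nhds) (fun _ _ _ => tendsto_const_nhds)
    apply tendsto_pF_mul (fun m d => Real.sqrt (N m) * Zc (Ng m) (Y m) (Atheta T 𝒢 (b j)) d)
      (fun m d => β j - betaHatStar 𝒢 (Ng m) a b (obs (Y m) d) d j)
      (Qf 𝒢 (fun g => (p g)⁻¹) Sstar (Atheta T 𝒢 (b j)) (Atheta T 𝒢 (b j)) + 1)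
    · filter_upwards [hQ.eventually_le_const (lt_add_one _)] with m hm
      refine le_trans (le_of_eq ?_) hm
      have h1 : ∀ d : Fin (N m) → 𝒢,
          (Real.sqrt (N m) * Zc (Ng m) (Y m) (Atheta T 𝒢 (b j)) d) ^ 2 = (N m : ℝ) *
            (Zc (Ng m) (Y m) (Atheta T 𝒢 (b j)) d * Zc (Ng m) (Y m) (Atheta T 𝒢 (b j)) d) := by
        intro d
        rw [mul_pow, Real.sq_sqrt (hNpos m).le, sq]
      simp_rw [h1]
      rw [expec_const_mul, expec_Zc_mul (hN2 m) (hNg m) (hsum m), totC_zero _ _ _ (hna m j),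
        sub_zero]
      rfl
    · have := (tendsto_const_nhds (x := β j) (f := pF N 𝒢 Ng)).sub (hβhat j)
      rw [sub_self] at this
      exact this
  have hW : ∀ t : ℝ, Tendsto (fun m => EC (N m) 𝒢 (Ng m) (fun d =>
      Complex.exp (Complex.I * (t * (Real.sqrt (N m) * Zc (Ng m) (Y m) (cB 𝒢 a b β) d + R m d) : ℝ))))
      atTop (𝓝 (Complex.exp
        (-(sigmaSqLim T M 𝒢 a b p Sstar Sthetastar * t ^ 2 / 2 : ℝ)))) := fun t =>
    slutsky hsum (fun m d => Real.sqrt (N m) * Zc (Ng m) (Y m) (cB 𝒢 a b β) d) R t _ hRlim (hclt t)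
  have hfin := levy hsum (fun m d => Real.sqrt (N m) * Zc (Ng m) (Y m) (cB 𝒢 a b β) d + R m d)
    _ hs hW f hf hfb
  refine hfin.congr fun m => ?_
  apply expec_congr
  intro d hd
  congr 1
  have h1 : thetaHat0 𝒢 (Ng m) a (obs (Y m) d) d - ∑ j, Xhat 𝒢 (Ng m) b (obs (Y m) d) d j * β j =
      thetaParam (N m) T 𝒢 (Y m) a + Zc (Ng m) (Y m) (cB 𝒢 a b β) d := by
    rw [← Lc_cB, Lc_eq (hNg m) (Y m) _ hd, Pc_cB a b β (Y m) (hna m)]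
  have h2 : ∀ j, Xhat 𝒢 (Ng m) b (obs (Y m) d) d j = Zc (Ng m) (Y m) (Atheta T 𝒢 (b j)) d := by
    intro j
    rw [Xhat_eq, Lc_eq (hNg m) (Y m) _ hd, noant_Pc (Y m) (b j) (hna m j), zero_add]
  have h3 : R m d = Real.sqrt (N m) * (∑ j, Xhat 𝒢 (Ng m) b (obs (Y m) d) d j * β j -
      ∑ j, Xhat 𝒢 (Ng m) b (obs (Y m) d) d j * betaHatStar 𝒢 (Ng m) a b (obs (Y m) d) d j) := by
    rw [hR, ← Finset.sum_sub_distrib, Finset.mul_sum]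
    refine Finset.sum_congr rfl fun j _ => ?_
    rw [h2 j]; ring
  unfold thetaHatPlug
  rw [h3]
  have h4 : Zc (Ng m) (Y m) (cB 𝒢 a b β) d = thetaHat0 𝒢 (Ng m) a (obs (Y m) d) d -
      ∑ j, Xhat 𝒢 (Ng m) b (obs (Y m) d) d j * β j - thetaParam (N m) T 𝒢 (Y m) a := by
    rw [h1]; ring
  rw [h4]
  ring

end plugin

end Staggered

namespace Staggered

/-- **Proposition 2.** Under Assumptions 1, 2, 3 with `V*_{X̂}` positive
definite, `√N(θ̂_{β̂*} - θ)` converges in distribution to `N(0, σ*²)` (stated via bounded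
continuous test functions), and `σ*² = lim N·Var(θ̂_{β*})` where `β*` is the oracle
coefficient in each population. -/
theorem statement12
    (T M : ℕ) (𝒢 : Finset Date) (N : ℕ → ℕ) (Ng : ℕ → Date → ℕ)
    (Y : ∀ m, Fin (N m) → Date → Fin T → ℝ)
    (a : Fin T → Date → Date → ℝ) (b : Fin M → Fin T → Date → Date → ℝ)
    (p : Date → ℝ) (Sstar : Date → Matrix (Fin T) (Fin T) ℝ)
    (SstarCross : Date → Date → Matrix (Fin T) (Fin T) ℝ) (Sthetastar : ℝ)
    (hN2 : ∀ m, 2 ≤ N m) (hNtop : Tendsto N atTop atTop)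
    (h𝒢ne : 𝒢.Nonempty) (h𝒢 : ∀ g ∈ 𝒢, (1 ≤ g ∧ g ≤ (T : Date)) ∨ g = ⊤)
    (hNg : ∀ m, ∀ g ∈ 𝒢, 1 ≤ Ng m g) (hsum : ∀ m, ∑ g ∈ 𝒢, Ng m g = N m)
    (hNA : ∀ m (i : Fin (N m)) (t : Fin T), ∀ g ∈ 𝒢, ∀ g' ∈ 𝒢,
      periodLT t g → periodLT t g' → Y m i g t = Y m i g' t)
    (hb : ∀ (j : Fin M) (t : Fin T) (g g' : Date),
      b j t g g' ≠ 0 → periodLT t g ∧ periodLT t g')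
    (hp : ∀ g ∈ 𝒢, 0 < p g ∧ p g < 1)
    (hpconv : ∀ g ∈ 𝒢, Tendsto (fun m => (Ng m g : ℝ) / (N m : ℝ)) atTop (𝓝 (p g)))
    (hSconv : ∀ g ∈ 𝒢, ∀ t t' : Fin T,
      Tendsto (fun m => Sg (N m) T (Y m) g t t') atTop (𝓝 (Sstar g t t')))
    (hScross : ∀ g ∈ 𝒢, ∀ g' ∈ 𝒢, ∀ t t' : Fin T,
      Tendsto (fun m => Sgg (N m) T (Y m) g g' t t') atTop (𝓝 (SstarCross g g' t t')))
    (hSpd : ∀ g ∈ 𝒢, (Sstar g).PosDef)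
    (hLind : ∀ ε > (0 : ℝ), ∀ᶠ m in atTop, ∀ (i : Fin (N m)), ∀ g ∈ 𝒢,
      (∑ t, (Y m i g t - popMeanS (N m) fun i' => Y m i' g t) ^ 2) / (N m : ℝ) < ε)
    (hSthetaconv : Tendsto (fun m => Stheta (N m) T 𝒢 (Y m) a) atTop (𝓝 Sthetastar))
    (hVXpd : (VstarX T M 𝒢 b p Sstar).PosDef) :
    (∀ f : ℝ → ℝ, Continuous f → IsBounded f →
      Tendsto (fun m => expec (N m) 𝒢 (Ng m) fun d =>
          f (Real.sqrt (N m : ℝ) *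
            (thetaHatPlug 𝒢 (Ng m) a b (obs (Y m) d) d - thetaParam (N m) T 𝒢 (Y m) a)))
        atTop
        (𝓝 (∫ x, f x ∂(gaussianReal 0
          (Real.toNNReal (sigmaSqLim T M 𝒢 a b p Sstar Sthetastar)))))) ∧
    Tendsto (fun m => (N m : ℝ) *
        varE (N m) 𝒢 (Ng m) (fun d =>
          thetaHat0 𝒢 (Ng m) a (obs (Y m) d) d -
            ∑ j, Xhat 𝒢 (Ng m) b (obs (Y m) d) d j *
              ((Matrix.of fun j' k : Fin M =>
                  covE (N m) 𝒢 (Ng m) (fun d' => Xhat 𝒢 (Ng m) b (obs (Y m) d') d' j')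
                    (fun d' => Xhat 𝒢 (Ng m) b (obs (Y m) d') d' k))⁻¹.mulVec
                (fun j' => covE (N m) 𝒢 (Ng m)
                  (fun d' => Xhat 𝒢 (Ng m) b (obs (Y m) d') d' j')
                  (fun d' => thetaHat0 𝒢 (Ng m) a (obs (Y m) d') d'))) j))
      atTop (𝓝 (sigmaSqLim T M 𝒢 a b p Sstar Sthetastar)) := by
  have hna : ∀ m j i, ∑ g ∈ 𝒢, Atheta T 𝒢 (b j) g ⬝ᵥ Y m i g = 0 := fun m j i =>
    noant (Y m) (b j) (hNA m) (hb j) i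
  have hw := tendsto_ratio hp hpconv
  have hdev := dev_bound hN2 hLind
  exact ⟨fun f hf hfb => plugin_clt N Ng Y a b p Sstar Sthetastar hN2 hNtop hNg hsum hna hp hw
      hSconv hSpd hdev hSthetaconv hVXpd f hf hfb,
    oracle_limit N Ng Y a b p Sstar Sthetastar hN2 hNg hsum hna hw hSconv hSpd hSthetaconv hVXpd⟩

end Staggered
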